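/- arXiv:2305.16178 — 10 statements merged into one kernel-verified Lean document; each statement's English description precedes it below -/
import Mathlib

section
/- Let u ∈ ℂ³ and let C be a symmetric 3×3 complex matrix, and set v = u × (Cu). Assume u·u ≠ 0 and v·v ≠ 0. Then there exist g ∈ SO₃(ℂ) and λ ∈ ℂ with λ² = u·u such that gu = (λ, 0, 0) and the (1,2) and (2,1) entries of gCgᵀ are both zero. (In other words, every generic pair (u,C) can be moved by the SO₃(ℂ)-action (u,C) ↦ (gu, gCgᵀ) into the linear section defined by u₂ = u₃ = 0 and c₁₂ = c₂₁ = 0.) -/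
open Matrix

/-- `SO₃(ℂ)`: complex 3×3 matrices with `gᵀ g = 1` and `det g = 1`. -/
def SO3 (g : Matrix (Fin 3) (Fin 3) ℂ) : Prop := gᵀ * g = 1 ∧ g.det = 1

/-- The rows `a`, `b`, `a × b` built from orthonormal vectors `a`, `b` (for the bilinear dot
product) form an element of `SO₃(ℂ)`. -/
theorem SO3_of_orthonormal_pair {a b : Fin 3 → ℂ} (ha : a ⬝ᵥ a = 1) (hb : b ⬝ᵥ b = 1)
    (hab : a ⬝ᵥ b = 0) : SO3 (of ![a, b, crossProduct a b]) := by
  have hba : b ⬝ᵥ a = 0 := by rw [dotProduct_comm, hab]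
  have hcc : crossProduct a b ⬝ᵥ crossProduct a b = 1 := by
    rw [cross_dot_cross, ha, hb, hab, hba]; ring
  constructor
  · rw [mul_eq_one_comm]
    ext i j
    change ![a, b, crossProduct a b] i ⬝ᵥ ![a, b, crossProduct a b] j = _
    fin_cases i <;> fin_cases j <;>
      simp [ha, hb, hab, hba, hcc, dotProduct_comm (crossProduct a b)]
  · change det ![a, b, crossProduct a b] = 1
    rw [← triple_product_eq_det, triple_product_permutation, triple_product_permutation, hcc]

/-- Entries of a congruence `g C gᵀ` in terms of the rows of `g`. -/
theorem mul_mul_transpose_apply_eq_dotProduct {m n R : Type*} [Fintype n] [CommSemiring R]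
    (g : Matrix m n R) (C : Matrix n n R) (i j : m) :
    (g * C * gᵀ) i j = g i ⬝ᵥ C *ᵥ g j := by
  rw [dotProduct_mulVec]
  rfl

/-- Every generic pair `(u, C)` with `C` symmetric can be moved by the SO₃(ℂ)-action
`(u, C) ↦ (gu, gCgᵀ)` into the linear section `u₂ = u₃ = 0`, `c₁₂ = c₂₁ = 0`. -/
theorem exists_move_to_section_symmetric (u : Fin 3 → ℂ) (C : Matrix (Fin 3) (Fin 3) ℂ)
    (hC : Cᵀ = C) (huu : u ⬝ᵥ u ≠ 0)
    (hvv : crossProduct u (C *ᵥ u) ⬝ᵥ crossProduct u (C *ᵥ u) ≠ 0) :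
    ∃ (g : Matrix (Fin 3) (Fin 3) ℂ) (lam : ℂ), SO3 g ∧ lam ^ 2 = u ⬝ᵥ u ∧
      g *ᵥ u = ![lam, 0, 0] ∧ (g * C * gᵀ) 0 1 = 0 ∧ (g * C * gᵀ) 1 0 = 0 := by
  obtain ⟨l, hl⟩ := IsAlgClosed.exists_pow_nat_eq (u ⬝ᵥ u) (n := 2) two_pos
  obtain ⟨m, hm⟩ := IsAlgClosed.exists_pow_nat_eq
    (crossProduct u (C *ᵥ u) ⬝ᵥ crossProduct u (C *ᵥ u)) (n := 2) two_pos
  have hl0 : l ≠ 0 := by rintro rfl; exact huu (by simp [← hl])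
  have hm0 : m ≠ 0 := by rintro rfl; exact hvv (by simp [← hm])
  set v := crossProduct u (C *ᵥ u)
  have huv : u ⬝ᵥ v = 0 := dot_self_cross _ _
  have hvu : v ⬝ᵥ u = 0 := by rw [dotProduct_comm, huv]
  have hvC : v ⬝ᵥ C *ᵥ u = 0 := by rw [dotProduct_comm]; exact dot_cross_self _ _
  have huC : u ⬝ᵥ C *ᵥ v = 0 := by
    rw [dotProduct_mulVec, ← mulVec_transpose, hC, dotProduct_comm, hvC]
  refine ⟨of ![l⁻¹ • u, m⁻¹ • v, crossProduct (l⁻¹ • u) (m⁻¹ • v)], l,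
    SO3_of_orthonormal_pair ?_ ?_ ?_, hl, ?_, ?_, ?_⟩
  · simp only [smul_dotProduct, dotProduct_smul, ← hl, smul_eq_mul]
    field_simp
  · simp only [smul_dotProduct, dotProduct_smul, ← hm, smul_eq_mul]
    field_simp
  · simp [huv]
  · ext i
    change ![l⁻¹ • u, m⁻¹ • v, crossProduct (l⁻¹ • u) (m⁻¹ • v)] i ⬝ᵥ u = _
    fin_cases i
    · simp only [Fin.zero_eta, cons_val_zero, smul_dotProduct, ← hl, smul_eq_mul]
      field_simp
    · simp [hvu]
    · simp [dotProduct_comm _ u]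
  · rw [mul_mul_transpose_apply_eq_dotProduct]
    change (l⁻¹ • u) ⬝ᵥ C *ᵥ (m⁻¹ • v) = 0
    simp [mulVec_smul, huC]
  · rw [mul_mul_transpose_apply_eq_dotProduct]
    change (m⁻¹ • v) ⬝ᵥ C *ᵥ (l⁻¹ • u) = 0
    simp [mulVec_smul, hvC]
end

section
/- Let u = (a, 0, 0) ∈ ℂ³ with a ≠ 0, and let C be a symmetric 3×3 complex matrix whose (1,2) entry is 0 and whose (1,3) entry is nonzero. If g ∈ SO₃(ℂ) is such that gu has vanishing second and third coordinates and gCgᵀ has vanishing (2,1) entry, then g is a diagonal matrix whose diagonal entries all equal ±1 (with determinant 1); in particular the Weyl group of the section {u₂ = u₃ = 0, c₁₂ = c₂₁ = 0} is the Klein four-group of diagonal sign matrices in SO₃(ℂ). -/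
open Matrix

/-- If a point of the section `{u₂ = u₃ = 0, c₁₂ = c₂₁ = 0}` (with `u₁ ≠ 0`, `c₁₃ ≠ 0`,
`C` symmetric) is mapped back into the section by `g ∈ SO₃(ℂ)`, then `g` is a diagonal
matrix with entries `±1` (the Weyl group is the Klein four-group of such matrices). -/
theorem weyl_group_symmetric_section (a : ℂ) (ha : a ≠ 0)
    (C : Matrix (Fin 3) (Fin 3) ℂ) (hC : Cᵀ = C) (hC12 : C 0 1 = 0) (hC13 : C 0 2 ≠ 0)
    (g : Matrix (Fin 3) (Fin 3) ℂ) (hg : SO3 g)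
    (hu2 : (g *ᵥ ![a, 0, 0]) 1 = 0) (hu3 : (g *ᵥ ![a, 0, 0]) 2 = 0)
    (hc21 : (g * C * gᵀ) 1 0 = 0) :
    ∃ e : Fin 3 → ℂ, (∀ i, e i = 1 ∨ e i = -1) ∧ e 0 * e 1 * e 2 = 1 ∧
      g = Matrix.diagonal e := by
  obtain ⟨ho, hd⟩ := hg
  have col (i j) := congrFun (congrFun ho i) j
  simp only [Matrix.mul_apply, Matrix.transpose_apply, Fin.sum_univ_three] at col
  have h10 : g 1 0 = 0 := by
    simpa [Matrix.mulVec, dotProduct, Fin.sum_univ_three, ha] using hu2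
  have h20 : g 2 0 = 0 := by
    simpa [Matrix.mulVec, dotProduct, Fin.sum_univ_three, ha] using hu3
  have h00 : g 0 0 * g 0 0 = 1 := by simpa [h10, h20] using col 0 0
  have h00' : g 0 0 ≠ 0 := left_ne_zero_of_mul_eq_one h00
  have h01 : g 0 1 = 0 := by simpa [h10, h20, h00'] using col 0 1
  have h02 : g 0 2 = 0 := by simpa [h10, h20, h00'] using col 0 2
  have hC10 : C 1 0 = 0 := (congrFun (congrFun hC 0) 1).trans hC12
  have hC20 : C 2 0 ≠ 0 := fun h => hC13 ((congrFun (congrFun hC 2) 0).trans h)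
  have h12 : g 1 2 = 0 := by
    simpa [Matrix.mul_apply, Fin.sum_univ_three, h10, h01, h02, hC10, hC20, h00'] using hc21
  have h22 : g 2 2 * g 2 2 = 1 := by simpa [h02, h12] using col 2 2
  have h22' : g 2 2 ≠ 0 := left_ne_zero_of_mul_eq_one h22
  have h21 : g 2 1 = 0 := by simpa [h02, h12, h22'] using col 1 2
  have h11 : g 1 1 * g 1 1 = 1 := by simpa [h01, h21] using col 1 1
  refine ⟨fun i => g i i, fun i => ?_, ?_, ?_⟩
  · fin_cases i
    exacts [mul_self_eq_one_iff.mp h00, mul_self_eq_one_iff.mp h11, mul_self_eq_one_iff.mp h22]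
  · simpa [Matrix.det_fin_three, h10, h20, h01, h02, h12, h21] using hd
  · ext i j
    fin_cases i <;> fin_cases j <;> simp [h10, h20, h01, h02, h12, h21]
end

section
/- Let (u, C) and (u′, C′) be two pairs, each consisting of a vector in ℂ³ and a symmetric 3×3 complex matrix, satisfying the genericity conditions u·u ≠ 0, v·v ≠ 0, u′·u′ ≠ 0, v′·v′ ≠ 0 (where v = u×(Cu) and v′ = u′×(C′u′)). If fᵢ(u, C) = fᵢ(u′, C′) for all i = 1, …, 6, then there exists g ∈ SO₃(ℂ) such that u′ = gu and C′ = gCgᵀ. (The six invariants separate SO₃(ℂ)-orbits in general position on symmetric states.) -/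
open Matrix

/-- The six invariants `f₁, …, f₆` of a pair `(u, C)`, where `v = u × (Cu)`, `w = u × v`:
`f₁ = u·u`, `f₂ = v·v`, `f₃ = u·(Cu)`, `f₄ = v·(Cv)`, `f₅ = w·(Cw)`, `f₆ = w·(Cv)`. -/
noncomputable def symF (u : Fin 3 → ℂ) (C : Matrix (Fin 3) (Fin 3) ℂ) : Fin 6 → ℂ :=
  let v := crossProduct u (C *ᵥ u)
  let w := crossProduct u v
  ![u ⬝ᵥ u, v ⬝ᵥ v, u ⬝ᵥ (C *ᵥ u), v ⬝ᵥ (C *ᵥ v), w ⬝ᵥ (C *ᵥ w), w ⬝ᵥ (C *ᵥ v)]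

/-- The matrix with rows `u`, `v = u × (Cu)` and `w = u × v`. -/
noncomputable def rowFrame (u : Fin 3 → ℂ) (C : Matrix (Fin 3) (Fin 3) ℂ) :
    Matrix (Fin 3) (Fin 3) ℂ :=
  of ![u, crossProduct u (C *ᵥ u), crossProduct u (crossProduct u (C *ᵥ u))]

theorem of_mul_mul_transpose_apply (r : Fin 3 → Fin 3 → ℂ) (C : Matrix (Fin 3) (Fin 3) ℂ)
    (i j : Fin 3) : (of r * C * (of r)ᵀ) i j = r i ⬝ᵥ (C *ᵥ r j) := by
  rw [dotProduct_mulVec]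
  rfl

theorem dotProduct_mulVec_comm_of_symm {C : Matrix (Fin 3) (Fin 3) ℂ} (hC : Cᵀ = C)
    (x y : Fin 3 → ℂ) : x ⬝ᵥ (C *ᵥ y) = y ⬝ᵥ (C *ᵥ x) := by
  rw [dotProduct_mulVec, dotProduct_comm, ← mulVec_transpose, hC]

theorem cross_cross_dotProduct (u x : Fin 3 → ℂ) :
    crossProduct u (crossProduct u x) ⬝ᵥ x = -(crossProduct u x ⬝ᵥ crossProduct u x) := by
  simp [crossProduct, dotProduct, Fin.sum_univ_three]
  ring

theorem cross_cross_dotProduct_self (u x : Fin 3 → ℂ) :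
    crossProduct u (crossProduct u x) ⬝ᵥ crossProduct u (crossProduct u x) =
      (u ⬝ᵥ u) * (crossProduct u x ⬝ᵥ crossProduct u x) := by
  simp [crossProduct, dotProduct, Fin.sum_univ_three]
  ring

theorem rowFrame_mul_transpose (u : Fin 3 → ℂ) (C : Matrix (Fin 3) (Fin 3) ℂ) :
    rowFrame u C * (rowFrame u C)ᵀ =
      diagonal ![symF u C 0, symF u C 1, symF u C 0 * symF u C 1] := by
  have huv := dot_self_cross u (C *ᵥ u)
  have huw := dot_self_cross u (crossProduct u (C *ᵥ u))
  have hvw := dot_cross_self u (crossProduct u (C *ᵥ u))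
  have hww := cross_cross_dotProduct_self u (C *ᵥ u)
  ext i j
  let r : Fin 3 → Fin 3 → ℂ :=
    ![u, crossProduct u (C *ᵥ u), crossProduct u (crossProduct u (C *ᵥ u))]
  change r i ⬝ᵥ r j = _
  fin_cases i <;> fin_cases j
  exacts [rfl, huv, huw, (dotProduct_comm _ _).trans huv, rfl, hvw,
    (dotProduct_comm _ _).trans huw, (dotProduct_comm _ _).trans hvw, hww]

theorem rowFrame_mul_mul_transpose (u : Fin 3 → ℂ) {C : Matrix (Fin 3) (Fin 3) ℂ}
    (hC : Cᵀ = C) :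
    rowFrame u C * C * (rowFrame u C)ᵀ =
      !![symF u C 2, 0, -symF u C 1;
         0, symF u C 3, symF u C 5;
         -symF u C 1, symF u C 5, symF u C 4] := by
  have hvu : crossProduct u (C *ᵥ u) ⬝ᵥ (C *ᵥ u) = 0 := by
    rw [dotProduct_comm, dot_cross_self]
  have hwu := cross_cross_dotProduct u (C *ᵥ u)
  have huv := (dotProduct_mulVec_comm_of_symm hC u (crossProduct u (C *ᵥ u))).trans hvu
  have huw := (dotProduct_mulVec_comm_of_symm hC u
    (crossProduct u (crossProduct u (C *ᵥ u)))).trans hwu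
  have hvw := dotProduct_mulVec_comm_of_symm hC (crossProduct u (C *ᵥ u))
    (crossProduct u (crossProduct u (C *ᵥ u)))
  ext i j
  rw [rowFrame, of_mul_mul_transpose_apply]
  fin_cases i <;> fin_cases j
  exacts [rfl, huv, huw, hvu, rfl, hvw, hwu, rfl, rfl]

theorem det_rowFrame (u : Fin 3 → ℂ) (C : Matrix (Fin 3) (Fin 3) ℂ) :
    (rowFrame u C).det = symF u C 0 * symF u C 1 := by
  change det ![u, crossProduct u (C *ᵥ u), crossProduct u (crossProduct u (C *ᵥ u))] = _
  rw [← triple_product_eq_det, triple_product_permutation, triple_product_permutation,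
    cross_cross_dotProduct_self]
  rfl

/-- The six invariants separate SO₃(ℂ)-orbits in general position on symmetric states. -/
theorem symF_separates_orbits (u u' : Fin 3 → ℂ) (C C' : Matrix (Fin 3) (Fin 3) ℂ)
    (hC : Cᵀ = C) (hC' : C'ᵀ = C')
    (huu : u ⬝ᵥ u ≠ 0)
    (hvv : crossProduct u (C *ᵥ u) ⬝ᵥ crossProduct u (C *ᵥ u) ≠ 0)
    (huu' : u' ⬝ᵥ u' ≠ 0)
    (hvv' : crossProduct u' (C' *ᵥ u') ⬝ᵥ crossProduct u' (C' *ᵥ u') ≠ 0)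
    (hf : ∀ i : Fin 6, symF u C i = symF u' C' i) :
    ∃ g : Matrix (Fin 3) (Fin 3) ℂ, SO3 g ∧ u' = g *ᵥ u ∧ C' = g * C * gᵀ := by
  have hdet : (rowFrame u C).det ≠ 0 := by
    rw [det_rowFrame]
    exact mul_ne_zero huu hvv
  have hdet_eq : (rowFrame u' C').det = (rowFrame u C).det := by
    simp only [det_rowFrame, hf]
  have hgram : rowFrame u' C' * (rowFrame u' C')ᵀ = rowFrame u C * (rowFrame u C)ᵀ := by
    simp only [rowFrame_mul_transpose, hf]
  have hform : rowFrame u' C' * C' * (rowFrame u' C')ᵀ =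
      rowFrame u C * C * (rowFrame u C)ᵀ := by
    simp only [rowFrame_mul_mul_transpose _ hC, rowFrame_mul_mul_transpose _ hC', hf]
  have hrow : rowFrame u C 0 = u := rfl
  have hrow' : rowFrame u' C' 0 = u' := rfl
  generalize rowFrame u C = R at *
  generalize rowFrame u' C' = R' at *
  have hunit : IsUnit R.det := isUnit_iff_ne_zero.mpr hdet
  set h := R⁻¹ * R' with hh
  have hR : R * h = R' := mul_nonsing_inv_cancel_left _ _ hunit
  have cancel : ∀ X : Matrix (Fin 3) (Fin 3) ℂ, R⁻¹ * (R * X * Rᵀ) * (R⁻¹)ᵀ = X := by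
    intro X
    rw [Matrix.mul_assoc R, nonsing_inv_mul_cancel_left _ _ hunit, Matrix.mul_assoc,
      ← transpose_mul, nonsing_inv_mul _ hunit, transpose_one, Matrix.mul_one]
  have hconj : ∀ X : Matrix (Fin 3) (Fin 3) ℂ,
      h * X * hᵀ = R⁻¹ * (R' * X * R'ᵀ) * (R⁻¹)ᵀ := by
    intro X
    simp only [hh, transpose_mul, Matrix.mul_assoc]
  have horth : h * hᵀ = 1 := by
    have := hconj 1
    rw [Matrix.mul_one, Matrix.mul_one, hgram] at this
    rw [this]
    simpa using cancel 1
  have horth' : hᵀ * h = 1 := mul_eq_one_comm.mp horth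
  have hCeq : h * C' * hᵀ = C := by rw [hconj, hform, cancel]
  refine ⟨hᵀ, ⟨by rw [transpose_transpose, horth], ?_⟩, ?_, ?_⟩
  · rw [det_transpose]
    apply mul_left_cancel₀ hdet
    rw [← det_mul, hR, hdet_eq, mul_one]
  · rw [mulVec_transpose, ← hrow, ← hrow', ← hR]
    rfl
  · rw [← hCeq, transpose_transpose]
    calc C' = (hᵀ * h) * C' * (hᵀ * h) := by rw [horth', Matrix.one_mul, Matrix.mul_one]
      _ = hᵀ * (h * C' * hᵀ) * h := by simp only [Matrix.mul_assoc]
end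

section
/- The six polynomials f₁, …, f₆, regarded as elements of the polynomial ring ℂ[u₁, u₂, u₃, c₁₁, c₁₂, c₁₃, c₂₂, c₂₃, c₃₃] in the nine coordinates of a pair (u, C) with C symmetric, are algebraically independent over ℂ. -/
open Matrix MvPolynomial

/-- The generic vector `u = (u₁, u₂, u₃)` with polynomial entries. -/
noncomputable def symU : Fin 3 → MvPolynomial (Fin 9) ℂ := ![X 0, X 1, X 2]

/-- The generic symmetric matrix `C = (cᵢⱼ)` with polynomial entries
`c₁₁, c₁₂, c₁₃, c₂₂, c₂₃, c₃₃`. -/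
noncomputable def symC : Matrix (Fin 3) (Fin 3) (MvPolynomial (Fin 9) ℂ) :=
  !![X 3, X 4, X 5; X 4, X 6, X 7; X 5, X 7, X 8]

/-- The six invariants `f₁, …, f₆` as polynomials in the nine coordinates
`u₁, u₂, u₃, c₁₁, c₁₂, c₁₃, c₂₂, c₂₃, c₃₃`, where `v = u × (Cu)`, `w = u × v`:
`f₁ = u·u`, `f₂ = v·v`, `f₃ = u·(Cu)`, `f₄ = v·(Cv)`, `f₅ = w·(Cw)`, `f₆ = w·(Cv)`. -/
noncomputable def symFpoly : Fin 6 → MvPolynomial (Fin 9) ℂ :=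
  let u := symU
  let C := symC
  let v := crossProduct u (C *ᵥ u)
  let w := crossProduct u v
  ![u ⬝ᵥ u, v ⬝ᵥ v, u ⬝ᵥ (C *ᵥ u), v ⬝ᵥ (C *ᵥ v), w ⬝ᵥ (C *ᵥ w), w ⬝ᵥ (C *ᵥ v)]

/-- Every point of `ℂ⁶` whose first two coordinates are nonzero is a value of `(f₁, …, f₆)`,
attained at some `u = (x, 0, 0)` and some `C` with `c₁₃ = 0`. -/
lemma exists_eval_symFpoly_eq (y : Fin 6 → ℂ) (h₀ : y 0 ≠ 0) (h₁ : y 1 ≠ 0) :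
    ∃ a : Fin 9 → ℂ, ∀ i, eval a (symFpoly i) = y i := by
  obtain ⟨x, hx⟩ := IsAlgClosed.exists_eq_mul_self (y 0)
  obtain ⟨s, hs⟩ := IsAlgClosed.exists_eq_mul_self (y 1)
  have hx₀ : x ≠ 0 := by rintro rfl; simp_all
  have hs₀ : s ≠ 0 := by rintro rfl; simp_all
  refine ⟨![x, 0, 0, y 2 / x ^ 2, s / x ^ 2, 0, y 4 / (x ^ 2 * s ^ 2), -y 5 / (x * s ^ 2),
    y 3 / s ^ 2], fun i => ?_⟩
  fin_cases i <;>
    simp [symFpoly, symU, symC, cross_apply, dotProduct, mulVec, Fin.sum_univ_three, hx, hs] <;>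
    field_simp

/-- The six polynomials `f₁, …, f₆` are algebraically independent over ℂ. -/
theorem symFpoly_algebraicIndependent : AlgebraicIndependent ℂ symFpoly := by
  rw [algebraicIndependent_iff]
  intro p hp
  have hmul : p * (X 0 * X 1) = 0 := by
    refine MvPolynomial.funext fun y => ?_
    by_cases h₀ : y 0 = 0
    · simp [h₀]
    by_cases h₁ : y 1 = 0
    · simp [h₁]
    obtain ⟨a, ha⟩ := exists_eval_symFpoly_eq y h₀ h₁
    have hval : eval a (aeval symFpoly p) = eval y p := by
      rw [← coe_aeval_eq_eval, RingHom.coe_coe, ← AlgHom.comp_apply, comp_aeval,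
        ← coe_aeval_eq_eval, RingHom.coe_coe]
      congr 2
      exact _root_.funext ha
    rw [hp, map_zero] at hval
    simp [← hval]
  simpa [X_ne_zero] using hmul
end

section
/- Let u₁, u₂ ∈ ℂ³ and let C be a 3×3 complex matrix. Set v₁ = u₁ × (Cu₂) and v₂ = u₂ × (Cᵀu₁), and assume u₁·u₁ ≠ 0, u₂·u₂ ≠ 0, v₁·v₁ ≠ 0, v₂·v₂ ≠ 0. Then there exist g₁, g₂ ∈ SO₃(ℂ) and λ₁, λ₂ ∈ ℂ with λ₁² = u₁·u₁ and λ₂² = u₂·u₂ such that g₁u₁ = (λ₁, 0, 0), g₂u₂ = (λ₂, 0, 0), and the (1,2) and (2,1) entries of g₁Cg₂ᵀ are both zero. (Every generic triple (u₁,u₂,C) can be moved by the action of SO₃(ℂ)×SO₃(ℂ) into the linear section defined by u₁,₂ = u₁,₃ = u₂,₂ = u₂,₃ = 0 and c₁₂ = c₂₁ = 0.) -/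
open Matrix

/-- For `u` and `u × w` anisotropic there is a frame in `SO₃(ℂ)` whose first vector is
proportional to `u` and whose second vector is orthogonal to `w`. -/
theorem exists_SO3_frame (u w : Fin 3 → ℂ) (hu : u ⬝ᵥ u ≠ 0)
    (hv : crossProduct u w ⬝ᵥ crossProduct u w ≠ 0) :
    ∃ (g : Matrix (Fin 3) (Fin 3) ℂ) (lam : ℂ), SO3 g ∧ lam ^ 2 = u ⬝ᵥ u ∧
      g *ᵥ u = ![lam, 0, 0] ∧ g 0 = lam⁻¹ • u ∧ g 1 ⬝ᵥ w = 0 := by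
  obtain ⟨l, hl⟩ := IsAlgClosed.exists_pow_nat_eq (u ⬝ᵥ u) two_pos
  obtain ⟨m, hm⟩ := IsAlgClosed.exists_pow_nat_eq (crossProduct u w ⬝ᵥ crossProduct u w) two_pos
  have hl0 : l ≠ 0 := by rintro rfl; simp [← hl] at hu
  have hm0 : m ≠ 0 := by rintro rfl; simp [← hm] at hv
  have huv : u ⬝ᵥ crossProduct u w = 0 := dot_self_cross u w
  have hvw : crossProduct u w ⬝ᵥ w = 0 := by rw [dotProduct_comm, dot_cross_self]
  refine ⟨of ![l⁻¹ • u, m⁻¹ • crossProduct u w,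
    crossProduct (l⁻¹ • u) (m⁻¹ • crossProduct u w)], l,
    SO3_of_orthonormal_pair ?_ ?_ ?_, hl, ?_, rfl, ?_⟩
  · simp only [smul_dotProduct, dotProduct_smul, ← hl, smul_eq_mul]; field_simp
  · simp only [smul_dotProduct, dotProduct_smul, ← hm, smul_eq_mul]; field_simp
  · simp only [smul_dotProduct, dotProduct_smul, huv, smul_zero]
  · ext i
    fin_cases i
    · change (l⁻¹ • u) ⬝ᵥ u = l
      rw [smul_dotProduct, ← hl, smul_eq_mul]; field_simp
    · change (m⁻¹ • crossProduct u w) ⬝ᵥ u = 0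
      rw [smul_dotProduct, dotProduct_comm, huv, smul_zero]
    · change crossProduct (l⁻¹ • u) (m⁻¹ • crossProduct u w) ⬝ᵥ u = 0
      rw [dotProduct_comm, LinearMap.map_smul₂, dotProduct_smul, dot_self_cross, smul_zero]
  · change (m⁻¹ • crossProduct u w) ⬝ᵥ w = 0
    rw [smul_dotProduct, hvw, smul_zero]

/-- Entries of `g C hᵀ` as values of the bilinear form `C` on the rows of `g` and `h`. -/
theorem mul_mul_transpose_apply {R l m n o : Type*} [CommSemiring R] [Fintype m] [Fintype n]
    (g : Matrix l m R) (C : Matrix m n R) (h : Matrix o n R) (i : l) (j : o) :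
    (g * C * hᵀ) i j = g i ⬝ᵥ (C *ᵥ h j) := by
  rw [Matrix.mul_assoc, mul_apply']
  rfl

/-- Every generic triple `(u₁, u₂, C)` can be moved by the SO₃(ℂ)×SO₃(ℂ)-action
`(u₁, u₂, C) ↦ (g₁u₁, g₂u₂, g₁Cg₂ᵀ)` into the linear section
`u₁,₂ = u₁,₃ = u₂,₂ = u₂,₃ = 0`, `c₁₂ = c₂₁ = 0`. -/
theorem exists_move_to_section_general (u₁ u₂ : Fin 3 → ℂ) (C : Matrix (Fin 3) (Fin 3) ℂ)
    (hu₁ : u₁ ⬝ᵥ u₁ ≠ 0) (hu₂ : u₂ ⬝ᵥ u₂ ≠ 0)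
    (hv₁ : crossProduct u₁ (C *ᵥ u₂) ⬝ᵥ crossProduct u₁ (C *ᵥ u₂) ≠ 0)
    (hv₂ : crossProduct u₂ (Cᵀ *ᵥ u₁) ⬝ᵥ crossProduct u₂ (Cᵀ *ᵥ u₁) ≠ 0) :
    ∃ (g₁ g₂ : Matrix (Fin 3) (Fin 3) ℂ) (lam₁ lam₂ : ℂ),
      SO3 g₁ ∧ SO3 g₂ ∧ lam₁ ^ 2 = u₁ ⬝ᵥ u₁ ∧ lam₂ ^ 2 = u₂ ⬝ᵥ u₂ ∧
      g₁ *ᵥ u₁ = ![lam₁, 0, 0] ∧ g₂ *ᵥ u₂ = ![lam₂, 0, 0] ∧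
      (g₁ * C * g₂ᵀ) 0 1 = 0 ∧ (g₁ * C * g₂ᵀ) 1 0 = 0 := by
  obtain ⟨g₁, l₁, hg₁, hl₁, hgu₁, hr₁, ho₁⟩ := exists_SO3_frame u₁ (C *ᵥ u₂) hu₁ hv₁
  obtain ⟨g₂, l₂, hg₂, hl₂, hgu₂, hr₂, ho₂⟩ := exists_SO3_frame u₂ (Cᵀ *ᵥ u₁) hu₂ hv₂
  refine ⟨g₁, g₂, l₁, l₂, hg₁, hg₂, hl₁, hl₂, hgu₁, hgu₂, ?_, ?_⟩
  · rw [mul_mul_transpose_apply, hr₁, smul_dotProduct, dotProduct_mulVec, ← mulVec_transpose,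
      dotProduct_comm, ho₂, smul_zero]
  · rw [mul_mul_transpose_apply, hr₂, mulVec_smul, dotProduct_smul, ho₁, smul_zero]
end

section
/- Let u₁ = (a, 0, 0) and u₂ = (b, 0, 0) in ℂ³ with a ≠ 0 and b ≠ 0, and let C be a 3×3 complex matrix whose (1,2) and (2,1) entries are 0 and whose (1,3) and (3,1) entries are both nonzero. If (g₁, g₂) ∈ SO₃(ℂ)×SO₃(ℂ) is such that g₁u₁ and g₂u₂ have vanishing second and third coordinates and g₁Cg₂ᵀ has vanishing (1,2) and (2,1) entries, then g₁ and g₂ are each diagonal matrices with all diagonal entries equal to ±1 (and determinant 1); in particular the Weyl group of the section is a finite abelian group of order 16, isomorphic to a product of two Klein four-groups. -/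
open Matrix

/-- An orthogonal matrix that keeps a nonzero multiple of the first basis vector on its axis is
block diagonal. -/
lemma SO3.block_of_mulVec {g : Matrix (Fin 3) (Fin 3) ℂ} (hg : SO3 g) {a : ℂ} (ha : a ≠ 0)
    (h₁ : (g *ᵥ ![a, 0, 0]) 1 = 0) (h₂ : (g *ᵥ ![a, 0, 0]) 2 = 0) :
    g 0 0 ≠ 0 ∧ g 1 0 = 0 ∧ g 2 0 = 0 ∧ g 0 1 = 0 ∧ g 0 2 = 0 := by
  have h10 : g 1 0 = 0 := by simpa [Matrix.mulVec, dotProduct, Fin.sum_univ_three, ha] using h₁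
  have h20 : g 2 0 = 0 := by simpa [Matrix.mulVec, dotProduct, Fin.sum_univ_three, ha] using h₂
  have e00 := congrFun (congrFun hg.1 0) 0
  have e01 := congrFun (congrFun hg.1 0) 1
  have e02 := congrFun (congrFun hg.1 0) 2
  simp only [Matrix.mul_apply, Matrix.transpose_apply, Fin.sum_univ_three, h10, h20,
    Matrix.one_apply] at e00 e01 e02
  have h00 : g 0 0 ≠ 0 := fun h => by simp [h] at e00
  refine ⟨h00, h10, h20, ?_, ?_⟩
  · simpa [h00] using e01
  · simpa [h00] using e02

/-- A block diagonal matrix in `SO₃(ℂ)` with lower triangular block is diagonal with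
entries `±1`. -/
lemma SO3.eq_diagonal {g : Matrix (Fin 3) (Fin 3) ℂ} (hg : SO3 g)
    (h10 : g 1 0 = 0) (h20 : g 2 0 = 0) (h01 : g 0 1 = 0) (h02 : g 0 2 = 0) (h12 : g 1 2 = 0) :
    ∃ e : Fin 3 → ℂ, (∀ i, e i = 1 ∨ e i = -1) ∧ e 0 * e 1 * e 2 = 1 ∧
      g = Matrix.diagonal e := by
  have e12 := congrFun (congrFun hg.1 1) 2
  have e22 := congrFun (congrFun hg.1 2) 2
  simp only [Matrix.mul_apply, Matrix.transpose_apply, Fin.sum_univ_three, h01, h02, h12,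
    Matrix.one_apply] at e12 e22
  have h22 : g 2 2 ≠ 0 := fun h => by simp [h] at e22
  have h21 : g 2 1 = 0 := by simpa [h22] using e12
  have hd : g = Matrix.diagonal fun i => g i i := by
    ext i j
    fin_cases i <;> fin_cases j <;> simp [h10, h20, h01, h02, h12, h21]
  refine ⟨fun i => g i i, fun i => ?_, ?_, hd⟩
  · have h := congrFun (congrFun hg.1 i) i
    rw [hd] at h
    simpa [mul_self_eq_one_iff] using h
  · have h := hg.2
    rw [hd, Matrix.det_diagonal, Fin.prod_univ_three] at h
    exact h

/-- If a generic point of the section `{u₁,₂ = u₁,₃ = u₂,₂ = u₂,₃ = 0, c₁₂ = c₂₁ = 0}`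
is mapped back into the section by `(g₁, g₂) ∈ SO₃(ℂ)×SO₃(ℂ)`, then `g₁` and `g₂` are
each diagonal matrices with entries `±1` (the Weyl group is a finite abelian group of
order 16, a product of two Klein four-groups). -/
theorem weyl_group_general_section (a b : ℂ) (ha : a ≠ 0) (hb : b ≠ 0)
    (C : Matrix (Fin 3) (Fin 3) ℂ)
    (hC12 : C 0 1 = 0) (hC21 : C 1 0 = 0) (hC13 : C 0 2 ≠ 0) (hC31 : C 2 0 ≠ 0)
    (g₁ g₂ : Matrix (Fin 3) (Fin 3) ℂ) (hg₁ : SO3 g₁) (hg₂ : SO3 g₂)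
    (hu₁2 : (g₁ *ᵥ ![a, 0, 0]) 1 = 0) (hu₁3 : (g₁ *ᵥ ![a, 0, 0]) 2 = 0)
    (hu₂2 : (g₂ *ᵥ ![b, 0, 0]) 1 = 0) (hu₂3 : (g₂ *ᵥ ![b, 0, 0]) 2 = 0)
    (hc12 : (g₁ * C * g₂ᵀ) 0 1 = 0) (hc21 : (g₁ * C * g₂ᵀ) 1 0 = 0) :
    ∃ e₁ e₂ : Fin 3 → ℂ,
      (∀ i, e₁ i = 1 ∨ e₁ i = -1) ∧ (∀ i, e₂ i = 1 ∨ e₂ i = -1) ∧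
      e₁ 0 * e₁ 1 * e₁ 2 = 1 ∧ e₂ 0 * e₂ 1 * e₂ 2 = 1 ∧
      g₁ = Matrix.diagonal e₁ ∧ g₂ = Matrix.diagonal e₂ := by
  obtain ⟨p00, p10, p20, p01, p02⟩ := hg₁.block_of_mulVec ha hu₁2 hu₁3
  obtain ⟨q00, q10, q20, q01, q02⟩ := hg₂.block_of_mulVec hb hu₂2 hu₂3
  have q12 : g₂ 1 2 = 0 := by
    simpa [Matrix.mul_apply, Fin.sum_univ_three, p01, p02, q10, hC12, p00, hC13] using hc12
  have p12 : g₁ 1 2 = 0 := by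
    simpa [Matrix.mul_apply, Fin.sum_univ_three, p10, q01, q02, hC21, q00, hC31] using hc21
  obtain ⟨e₁, h₁, d₁, rfl⟩ := hg₁.eq_diagonal p10 p20 p01 p02 p12
  obtain ⟨e₂, h₂, d₂, rfl⟩ := hg₂.eq_diagonal q10 q20 q01 q02 q12
  exact ⟨e₁, e₂, h₁, h₂, d₁, d₂, rfl, rfl⟩
end

section
/- For every (g₁, g₂) ∈ SO₃(ℂ)×SO₃(ℂ), all u₁, u₂ ∈ ℂ³, and every 3×3 complex matrix C, each of the nine functions f₁, …, f₉ is invariant under the action (u₁,u₂,C) ↦ (g₁u₁, g₂u₂, g₁Cg₂ᵀ); that is, fᵢ(g₁u₁, g₂u₂, g₁Cg₂ᵀ) = fᵢ(u₁, u₂, C) for i = 1, …, 9. -/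
open Matrix

/-- The nine invariants `f₁, …, f₉` of a triple `(u₁, u₂, C)`, where `v₁ = u₁ × (Cu₂)`,
`v₂ = u₂ × (Cᵀu₁)`, `w₁ = u₁ × v₁`, `w₂ = u₂ × v₂`:
`f₁ = u₁·u₁`, `f₂ = u₂·u₂`, `f₃ = v₁·v₁`, `f₄ = v₂·v₂`, `f₅ = u₁·(Cu₂)`,
`f₆ = v₁·(Cv₂)`, `f₇ = w₁·(Cw₂)`, `f₈ = v₁·(Cw₂)`, `f₉ = w₁·(Cv₂)`. -/
noncomputable def genF (u₁ u₂ : Fin 3 → ℂ) (C : Matrix (Fin 3) (Fin 3) ℂ) : Fin 9 → ℂ :=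
  let v₁ := crossProduct u₁ (C *ᵥ u₂)
  let v₂ := crossProduct u₂ (Cᵀ *ᵥ u₁)
  let w₁ := crossProduct u₁ v₁
  let w₂ := crossProduct u₂ v₂
  ![u₁ ⬝ᵥ u₁, u₂ ⬝ᵥ u₂, v₁ ⬝ᵥ v₁, v₂ ⬝ᵥ v₂, u₁ ⬝ᵥ (C *ᵥ u₂),
    v₁ ⬝ᵥ (C *ᵥ v₂), w₁ ⬝ᵥ (C *ᵥ w₂), v₁ ⬝ᵥ (C *ᵥ w₂), w₁ ⬝ᵥ (C *ᵥ v₂)]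

theorem transpose_mulVec_crossProduct_mulVec {R : Type*} [CommRing R]
    (g : Matrix (Fin 3) (Fin 3) R) (a b : Fin 3 → R) :
    gᵀ *ᵥ crossProduct (g *ᵥ a) (g *ᵥ b) = g.det • crossProduct a b := by
  ext i
  fin_cases i <;>
    simp [cross_apply, mulVec, dotProduct, Fin.sum_univ_three, det_fin_three] <;> ring

theorem SO3.crossProduct_mulVec {g : Matrix (Fin 3) (Fin 3) ℂ} (hg : SO3 g) (a b : Fin 3 → ℂ) :
    crossProduct (g *ᵥ a) (g *ᵥ b) = g *ᵥ crossProduct a b := by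
  have h := congrArg (g *ᵥ ·) (transpose_mulVec_crossProduct_mulVec g a b)
  simpa [mulVec_mulVec, mul_eq_one_comm.mp hg.1, hg.2] using h

theorem SO3.dotProduct_mulVec_mulVec {g : Matrix (Fin 3) (Fin 3) ℂ} (hg : SO3 g)
    (a b : Fin 3 → ℂ) : (g *ᵥ a) ⬝ᵥ (g *ᵥ b) = a ⬝ᵥ b := by
  rw [dotProduct_mulVec, ← mulVec_transpose, mulVec_mulVec, hg.1, one_mulVec]

theorem SO3.mul_mul_transpose_mulVec {g : Matrix (Fin 3) (Fin 3) ℂ} (hg : SO3 g)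
    (h C : Matrix (Fin 3) (Fin 3) ℂ) (a : Fin 3 → ℂ) :
    (h * C * gᵀ) *ᵥ (g *ᵥ a) = h *ᵥ (C *ᵥ a) := by
  rw [mulVec_mulVec, Matrix.mul_assoc, hg.1, Matrix.mul_one, mulVec_mulVec]

/-- Each of the nine functions `f₁, …, f₉` is invariant under the SO₃(ℂ)×SO₃(ℂ)-action
`(u₁, u₂, C) ↦ (g₁u₁, g₂u₂, g₁Cg₂ᵀ)`. -/
theorem genF_invariant (g₁ g₂ : Matrix (Fin 3) (Fin 3) ℂ) (hg₁ : SO3 g₁) (hg₂ : SO3 g₂)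
    (u₁ u₂ : Fin 3 → ℂ) (C : Matrix (Fin 3) (Fin 3) ℂ) (i : Fin 9) :
    genF (g₁ *ᵥ u₁) (g₂ *ᵥ u₂) (g₁ * C * g₂ᵀ) i = genF u₁ u₂ C i := by
  have hC : (g₁ * C * g₂ᵀ)ᵀ = g₂ * Cᵀ * g₁ᵀ := by
    simp [transpose_mul, Matrix.mul_assoc]
  simp only [genF, hC, hg₁.mul_mul_transpose_mulVec, hg₂.mul_mul_transpose_mulVec,
    hg₁.crossProduct_mulVec, hg₂.crossProduct_mulVec,
    hg₁.dotProduct_mulVec_mulVec, hg₂.dotProduct_mulVec_mulVec]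
end

section
/- Let (u₁, u₂, C) and (u₁′, u₂′, C′) be two triples, each consisting of two vectors in ℂ³ and a 3×3 complex matrix, satisfying the genericity conditions uᵢ·uᵢ ≠ 0 and vᵢ·vᵢ ≠ 0 for i = 1, 2 (where v₁ = u₁×(Cu₂), v₂ = u₂×(Cᵀu₁), and similarly for the primed triple). If fᵢ(u₁, u₂, C) = fᵢ(u₁′, u₂′, C′) for all i = 1, …, 9, then there exists (g₁, g₂) ∈ SO₃(ℂ)×SO₃(ℂ) such that u₁′ = g₁u₁, u₂′ = g₂u₂, and C′ = g₁Cg₂ᵀ. (The nine invariants separate orbits in general position.) -/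
open Matrix

/-- The matrix with rows `u`, `v`, `u × v`. -/
def crossFrame (u v : Fin 3 → ℂ) : Matrix (Fin 3) (Fin 3) ℂ :=
  Matrix.of ![u, v, crossProduct u v]

theorem mul_mul_transpose_apply_eq_dotProduct_s13 (A C B : Matrix (Fin 3) (Fin 3) ℂ) (i j : Fin 3) :
    (A * C * Bᵀ) i j = A i ⬝ᵥ (C *ᵥ B j) := by
  rw [dotProduct_mulVec]
  rfl

theorem crossFrame_mul_transpose (u v : Fin 3 → ℂ) (h : u ⬝ᵥ v = 0) :
    crossFrame u v * (crossFrame u v)ᵀ = diagonal ![u ⬝ᵥ u, v ⬝ᵥ v, (u ⬝ᵥ u) * (v ⬝ᵥ v)] := by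
  have h' : v ⬝ᵥ u = 0 := by rw [dotProduct_comm, h]
  have e (i j : Fin 3) : (crossFrame u v * (crossFrame u v)ᵀ) i j =
      (![u, v, crossProduct u v] i : Fin 3 → ℂ) ⬝ᵥ ![u, v, crossProduct u v] j := rfl
  ext i j
  rw [e]
  fin_cases i <;> fin_cases j <;>
    simp [h, h', cross_dot_cross, dot_self_cross, dot_cross_self,
      dotProduct_comm (crossProduct u v)]

theorem det_crossFrame (u v : Fin 3 → ℂ) (h : u ⬝ᵥ v = 0) :
    (crossFrame u v).det = (u ⬝ᵥ u) * (v ⬝ᵥ v) := by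
  have h' : v ⬝ᵥ u = 0 := by rw [dotProduct_comm, h]
  have := triple_product_eq_det u v (crossProduct u v)
  rw [crossFrame]
  change Matrix.det ![u, v, crossProduct u v] = _
  rw [← this, triple_product_permutation, triple_product_permutation, cross_dot_cross, h, h']
  ring

theorem exists_SO3_of_gram_eq {F F' : Matrix (Fin 3) (Fin 3) ℂ} (hdet : F.det ≠ 0)
    (hF : F'.det = F.det) (hgram : F' * F'ᵀ = F * Fᵀ) :
    ∃ g, SO3 g ∧ F'ᵀ = g * Fᵀ := by
  have hu : IsUnit F.det := isUnit_iff_ne_zero.2 hdet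
  have hut : IsUnit Fᵀ.det := by rwa [det_transpose]
  refine ⟨F'ᵀ * (Fᵀ)⁻¹, ⟨?_, ?_⟩, ?_⟩
  · rw [transpose_mul, transpose_transpose, ← transpose_nonsing_inv, transpose_transpose,
      Matrix.mul_assoc, ← Matrix.mul_assoc F', hgram, transpose_nonsing_inv, Matrix.mul_assoc F,
      mul_nonsing_inv _ hut, Matrix.mul_one, nonsing_inv_mul _ hu]
  · rw [det_mul, det_transpose, hF, ← det_transpose F, ← det_mul, mul_nonsing_inv _ hut, det_one]
  · rw [Matrix.mul_assoc, nonsing_inv_mul _ hut, Matrix.mul_one]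

theorem exists_SO3_map_eq {u v u' v' : Fin 3 → ℂ} (h : u ⬝ᵥ v = 0) (h' : u' ⬝ᵥ v' = 0)
    (hu : u ⬝ᵥ u ≠ 0) (hv : v ⬝ᵥ v ≠ 0) (huu : u ⬝ᵥ u = u' ⬝ᵥ u') (hvv : v ⬝ᵥ v = v' ⬝ᵥ v') :
    ∃ g, SO3 g ∧ (crossFrame u' v')ᵀ = g * (crossFrame u v)ᵀ := by
  apply exists_SO3_of_gram_eq
  · rw [det_crossFrame u v h]
    exact mul_ne_zero hu hv
  · rw [det_crossFrame u v h, det_crossFrame u' v' h', huu, hvv]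
  · rw [crossFrame_mul_transpose u v h, crossFrame_mul_transpose u' v' h', huu, hvv]

theorem dotProduct_cross_cross_self (u c : Fin 3 → ℂ) :
    c ⬝ᵥ crossProduct u (crossProduct u c) = -(crossProduct u c ⬝ᵥ crossProduct u c) := by
  rw [triple_product_permutation, triple_product_permutation, ← cross_anticomm u c,
    dotProduct_neg]

theorem crossFrame_mul_mul_transpose (u₁ u₂ : Fin 3 → ℂ) (C : Matrix (Fin 3) (Fin 3) ℂ) :
    crossFrame u₁ (crossProduct u₁ (C *ᵥ u₂)) * C *
        (crossFrame u₂ (crossProduct u₂ (Cᵀ *ᵥ u₁)))ᵀ =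
      !![genF u₁ u₂ C 4, 0, -genF u₁ u₂ C 3;
         0, genF u₁ u₂ C 5, genF u₁ u₂ C 7;
         -genF u₁ u₂ C 2, genF u₁ u₂ C 8, genF u₁ u₂ C 6] := by
  have left (x : Fin 3 → ℂ) : u₁ ⬝ᵥ (C *ᵥ x) = (Cᵀ *ᵥ u₁) ⬝ᵥ x := by
    rw [dotProduct_mulVec, mulVec_transpose]
  ext i j
  rw [mul_mul_transpose_apply_eq_dotProduct_s13]
  fin_cases i <;> fin_cases j
  · rfl
  · change u₁ ⬝ᵥ (C *ᵥ crossProduct u₂ (Cᵀ *ᵥ u₁)) = 0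
    rw [left, dot_cross_self]
  · change u₁ ⬝ᵥ (C *ᵥ crossProduct u₂ (crossProduct u₂ (Cᵀ *ᵥ u₁))) = _
    rw [left, dotProduct_cross_cross_self]
    rfl
  · change crossProduct u₁ (C *ᵥ u₂) ⬝ᵥ (C *ᵥ u₂) = 0
    rw [dotProduct_comm, dot_cross_self]
  · rfl
  · rfl
  · change crossProduct u₁ (crossProduct u₁ (C *ᵥ u₂)) ⬝ᵥ (C *ᵥ u₂) = _
    rw [dotProduct_comm, dotProduct_cross_cross_self]
    rfl
  · rfl
  · rfl

theorem eq_mulVec_of_crossFrame_eq {u v u' v' : Fin 3 → ℂ} {g : Matrix (Fin 3) (Fin 3) ℂ}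
    (h : (crossFrame u' v')ᵀ = g * (crossFrame u v)ᵀ) : u' = g *ᵥ u := by
  ext i
  exact congrFun (congrFun h i) 0

/-- The nine invariants separate SO₃(ℂ)×SO₃(ℂ)-orbits in general position. -/
theorem genF_separates_orbits (u₁ u₂ u₁' u₂' : Fin 3 → ℂ)
    (C C' : Matrix (Fin 3) (Fin 3) ℂ)
    (hu₁ : u₁ ⬝ᵥ u₁ ≠ 0) (hu₂ : u₂ ⬝ᵥ u₂ ≠ 0)
    (hv₁ : crossProduct u₁ (C *ᵥ u₂) ⬝ᵥ crossProduct u₁ (C *ᵥ u₂) ≠ 0)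
    (hv₂ : crossProduct u₂ (Cᵀ *ᵥ u₁) ⬝ᵥ crossProduct u₂ (Cᵀ *ᵥ u₁) ≠ 0)
    (hu₁' : u₁' ⬝ᵥ u₁' ≠ 0) (hu₂' : u₂' ⬝ᵥ u₂' ≠ 0)
    (hv₁' : crossProduct u₁' (C' *ᵥ u₂') ⬝ᵥ crossProduct u₁' (C' *ᵥ u₂') ≠ 0)
    (hv₂' : crossProduct u₂' (C'ᵀ *ᵥ u₁') ⬝ᵥ crossProduct u₂' (C'ᵀ *ᵥ u₁') ≠ 0)
    (hf : ∀ i : Fin 9, genF u₁ u₂ C i = genF u₁' u₂' C' i) :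
    ∃ g₁ g₂ : Matrix (Fin 3) (Fin 3) ℂ, SO3 g₁ ∧ SO3 g₂ ∧
      u₁' = g₁ *ᵥ u₁ ∧ u₂' = g₂ *ᵥ u₂ ∧ C' = g₁ * C * g₂ᵀ := by
  have o₁ := dot_self_cross u₁ (C *ᵥ u₂)
  have o₂ := dot_self_cross u₂ (Cᵀ *ᵥ u₁)
  have o₁' := dot_self_cross u₁' (C' *ᵥ u₂')
  have o₂' := dot_self_cross u₂' (C'ᵀ *ᵥ u₁')
  obtain ⟨g₁, hg₁, h₁⟩ := exists_SO3_map_eq o₁ o₁' hu₁ hv₁ (hf 0) (hf 2)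
  obtain ⟨g₂, hg₂, h₂⟩ := exists_SO3_map_eq o₂ o₂' hu₂ hv₂ (hf 1) (hf 3)
  refine ⟨g₁, g₂, hg₁, hg₂, eq_mulVec_of_crossFrame_eq h₁, eq_mulVec_of_crossFrame_eq h₂, ?_⟩
  have key : crossFrame u₁' (crossProduct u₁' (C' *ᵥ u₂')) * C' *
        (crossFrame u₂' (crossProduct u₂' (C'ᵀ *ᵥ u₁')))ᵀ =
      crossFrame u₁ (crossProduct u₁ (C *ᵥ u₂)) * C *
        (crossFrame u₂ (crossProduct u₂ (Cᵀ *ᵥ u₁)))ᵀ := by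
    simp only [crossFrame_mul_mul_transpose, hf]
  have d₁ := det_crossFrame _ _ o₁'
  have d₂ := det_crossFrame _ _ o₂'
  have n₁ := mul_ne_zero hu₁' hv₁'
  have n₂ := mul_ne_zero hu₂' hv₂'
  rw [← d₁] at n₁
  rw [← d₂] at n₂
  generalize crossFrame u₁' (crossProduct u₁' (C' *ᵥ u₂')) = F₁' at *
  generalize crossFrame u₂' (crossProduct u₂' (C'ᵀ *ᵥ u₁')) = F₂' at *
  generalize crossFrame u₁ (crossProduct u₁ (C *ᵥ u₂)) = F₁ at *
  generalize crossFrame u₂ (crossProduct u₂ (Cᵀ *ᵥ u₁)) = F₂ at *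
  have i₁ : IsUnit F₁' := (isUnit_iff_isUnit_det _).2 (isUnit_iff_ne_zero.2 n₁)
  have i₂ : IsUnit F₂'ᵀ := by
    rw [isUnit_iff_isUnit_det, det_transpose]
    exact isUnit_iff_ne_zero.2 n₂
  have e₁ : F₁' * g₁ = F₁ := by
    have : F₁' = F₁ * g₁ᵀ := by
      rw [← transpose_transpose F₁', h₁, transpose_mul, transpose_transpose]
    rw [this, Matrix.mul_assoc, hg₁.1, Matrix.mul_one]
  have e₂ : g₂ᵀ * F₂'ᵀ = F₂ᵀ := by
    rw [h₂, ← Matrix.mul_assoc, hg₂.1, Matrix.one_mul]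
  apply i₁.mul_left_cancel
  apply i₂.mul_right_cancel
  rw [key, ← e₁, ← e₂]
  simp only [Matrix.mul_assoc]
end

section
/- The nine polynomials f₁, …, f₉, regarded as elements of the polynomial ring over ℂ in the 15 coordinates of a triple (u₁, u₂, C) (three coordinates for each of u₁ and u₂, and nine entries of C), are algebraically independent over ℂ. -/
open Matrix MvPolynomial

/-- The generic vector `u₁` with polynomial entries. -/
noncomputable def genU₁ : Fin 3 → MvPolynomial (Fin 15) ℂ := ![X 0, X 1, X 2]

/-- The generic vector `u₂` with polynomial entries. -/
noncomputable def genU₂ : Fin 3 → MvPolynomial (Fin 15) ℂ := ![X 3, X 4, X 5]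

/-- The generic 3×3 matrix `C = (cᵢⱼ)` with polynomial entries. -/
noncomputable def genC : Matrix (Fin 3) (Fin 3) (MvPolynomial (Fin 15) ℂ) :=
  !![X 6, X 7, X 8; X 9, X 10, X 11; X 12, X 13, X 14]

/-- The nine invariants `f₁, …, f₉` as polynomials in the 15 coordinates of
`(u₁, u₂, C)`, where `v₁ = u₁ × (Cu₂)`, `v₂ = u₂ × (Cᵀu₁)`, `w₁ = u₁ × v₁`,
`w₂ = u₂ × v₂`:  `f₁ = u₁·u₁`, `f₂ = u₂·u₂`, `f₃ = v₁·v₁`, `f₄ = v₂·v₂`,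
`f₅ = u₁·(Cu₂)`, `f₆ = v₁·(Cv₂)`, `f₇ = w₁·(Cw₂)`, `f₈ = v₁·(Cw₂)`, `f₉ = w₁·(Cv₂)`. -/
noncomputable def genFpoly : Fin 9 → MvPolynomial (Fin 15) ℂ :=
  let u₁ := genU₁
  let u₂ := genU₂
  let C := genC
  let v₁ := crossProduct u₁ (C *ᵥ u₂)
  let v₂ := crossProduct u₂ (Cᵀ *ᵥ u₁)
  let w₁ := crossProduct u₁ v₁
  let w₂ := crossProduct u₂ v₂
  ![u₁ ⬝ᵥ u₁, u₂ ⬝ᵥ u₂, v₁ ⬝ᵥ v₁, v₂ ⬝ᵥ v₂, u₁ ⬝ᵥ (C *ᵥ u₂),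
    v₁ ⬝ᵥ (C *ᵥ v₂), w₁ ⬝ᵥ (C *ᵥ w₂), v₁ ⬝ᵥ (C *ᵥ w₂), w₁ ⬝ᵥ (C *ᵥ v₂)]

/-- Monomials whose exponent vectors are linearly independent over `ℕ` are algebraically
independent. -/
theorem MvPolynomial.algebraicIndependent_monomial {σ ι R : Type*} [CommRing R] (e : ι → σ →₀ ℕ)
    (he : LinearIndependent ℕ e) :
    AlgebraicIndependent R fun i => (monomial (e i) 1 : MvPolynomial σ R) := by
  have key : aeval (fun i => (monomial (e i) 1 : MvPolynomial σ R)) =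
      AddMonoidAlgebra.mapDomainAlgHom R R
        (Finsupp.linearCombination ℕ e).toAddMonoidHom := by
    refine MvPolynomial.algHom_ext fun i => ?_
    rw [aeval_X, X, monomial, AddMonoidAlgebra.lsingle_apply]
    simp [monomial, MvPolynomial]
  rw [algebraicIndependent_iff_injective_aeval, key]
  exact AddMonoidAlgebra.mapDomain_injective he

/-- The specialization of the 15 coordinates to a normal form with nine free parameters, in which
both vectors are multiples of the first basis vector. -/
noncomputable def normalForm : Fin 15 → MvPolynomial (Fin 9) ℂ :=
  ![X 0, 0, 0, X 1, 0, 0, X 4, X 3, 0, X 2, X 6, -X 8, 0, -X 7, X 5]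

/-- The exponent vectors of the monomials to which the nine invariants specialize in normal form. -/
def normalFormExponent : Fin 9 → Fin 9 → ℕ :=
  ![![2, 0, 0, 0, 0, 0, 0, 0, 0],
    ![0, 2, 0, 0, 0, 0, 0, 0, 0],
    ![2, 2, 2, 0, 0, 0, 0, 0, 0],
    ![2, 2, 0, 2, 0, 0, 0, 0, 0],
    ![1, 1, 0, 0, 1, 0, 0, 0, 0],
    ![2, 2, 1, 1, 0, 1, 0, 0, 0],
    ![3, 3, 1, 1, 0, 0, 1, 0, 0],
    ![2, 3, 1, 1, 0, 0, 0, 1, 0],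
    ![3, 2, 1, 1, 0, 0, 0, 0, 1]]

theorem linearIndependent_normalFormExponent :
    LinearIndependent ℕ fun i => Finsupp.equivFunOnFinite.symm (normalFormExponent i) := by
  refine Fintype.linearIndependent_iffₛ.mpr fun c d h => ?_
  have h' (j : Fin 9) : ∑ i, c i * normalFormExponent i j = ∑ i, d i * normalFormExponent i j := by
    simpa [Finsupp.finsetSum_apply] using DFunLike.congr_fun h j
  simp only [Fin.sum_univ_succ, Fin.forall_fin_succ, normalFormExponent] at h'
  simp at h'
  simp only [Fin.forall_fin_succ]
  simp
  omega

theorem aeval_normalForm_genFpoly (i : Fin 9) :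
    aeval normalForm (genFpoly i) =
      monomial (Finsupp.equivFunOnFinite.symm (normalFormExponent i)) 1 := by
  rw [monomial_eq, Finsupp.prod_fintype _ _ (by simp)]
  fin_cases i <;>
  simp [genFpoly, genU₁, genU₂, genC, normalForm, normalFormExponent, cross_apply,
    Matrix.mulVec, dotProduct, Fin.sum_univ_succ, Fin.prod_univ_succ] <;>
  ring

/-- The nine polynomials `f₁, …, f₉` are algebraically independent over ℂ. -/
theorem genFpoly_algebraicIndependent : AlgebraicIndependent ℂ genFpoly := by
  refine AlgebraicIndependent.of_comp (aeval normalForm) ?_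
  convert algebraicIndependent_monomial _ linearIndependent_normalFormExponent using 1
  exact funext aeval_normalForm_genFpoly
end

section
/- Let K be the field of rational functions over ℂ in the 15 coordinates of a triple (u₁, u₂, C), equipped with the action of G = SO₃(ℂ)×SO₃(ℂ) by field automorphisms induced by precomposition with the linear action (u₁,u₂,C) ↦ (g₁u₁, g₂u₂, g₁Cg₂ᵀ). Then the fixed field K^G is purely transcendental of transcendence degree 9 over ℂ: there exist nine elements of K^G that are algebraically independent over ℂ and generate K^G as a field extension of ℂ. (The field of rational local unitary invariants of mixed states of two qubits is rational of degree 9.) -/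
open Matrix MvPolynomial

/-- The SO₃(ℂ)×SO₃(ℂ)-action on the 15 coordinates of a triple `(u₁, u₂, C)`,
given by `(u₁, u₂, C) ↦ (g₁u₁, g₂u₂, g₁Cg₂ᵀ)`. -/
noncomputable def genAct (g₁ g₂ : Matrix (Fin 3) (Fin 3) ℂ) (x : Fin 15 → ℂ) :
    Fin 15 → ℂ :=
  let u₁ : Fin 3 → ℂ := ![x 0, x 1, x 2]
  let u₂ : Fin 3 → ℂ := ![x 3, x 4, x 5]
  let C : Matrix (Fin 3) (Fin 3) ℂ :=
    !![x 6, x 7, x 8; x 9, x 10, x 11; x 12, x 13, x 14]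
  let u₁' := g₁ *ᵥ u₁
  let u₂' := g₂ *ᵥ u₂
  let C' := g₁ * C * g₂ᵀ
  ![u₁' 0, u₁' 1, u₁' 2, u₂' 0, u₂' 1, u₂' 2,
    C' 0 0, C' 0 1, C' 0 2, C' 1 0, C' 1 1, C' 1 2, C' 2 0, C' 2 1, C' 2 2]

/-- Functions `ℂⁿ → ℂ` given by a polynomial. -/
def IsPolyFun {n : ℕ} (f : (Fin n → ℂ) → ℂ) : Prop :=
  ∃ p : MvPolynomial (Fin n) ℂ, ∀ z, eval z p = f z

namespace IsPolyFun

variable {n m : ℕ} {f g : (Fin n → ℂ) → ℂ}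

theorem const (c : ℂ) : IsPolyFun fun _ : Fin n → ℂ => c := ⟨C c, fun _ => eval_C c⟩

theorem coord (i : Fin n) : IsPolyFun fun z : Fin n → ℂ => z i := ⟨X i, fun _ => eval_X i⟩

theorem add (hf : IsPolyFun f) (hg : IsPolyFun g) : IsPolyFun fun z => f z + g z := by
  obtain ⟨p, hp⟩ := hf
  obtain ⟨q, hq⟩ := hg
  exact ⟨p + q, fun z => by rw [map_add, hp, hq]⟩

theorem mul (hf : IsPolyFun f) (hg : IsPolyFun g) : IsPolyFun fun z => f z * g z := by
  obtain ⟨p, hp⟩ := hf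
  obtain ⟨q, hq⟩ := hg
  exact ⟨p * q, fun z => by rw [map_mul, hp, hq]⟩

theorem neg (hf : IsPolyFun f) : IsPolyFun fun z => -f z := by
  simpa using (const (-1)).mul hf

theorem sub (hf : IsPolyFun f) (hg : IsPolyFun g) : IsPolyFun fun z => f z - g z := by
  simpa [sub_eq_add_neg] using hf.add hg.neg

theorem pow (hf : IsPolyFun f) (k : ℕ) : IsPolyFun fun z => f z ^ k := by
  obtain ⟨p, hp⟩ := hf
  exact ⟨p ^ k, fun z => by rw [map_pow, hp]⟩

theorem comp (hf : IsPolyFun f) {φ : (Fin m → ℂ) → Fin n → ℂ}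
    (hφ : ∀ i, IsPolyFun fun z => φ z i) : IsPolyFun fun z => f (φ z) := by
  obtain ⟨p, hp⟩ := hf
  choose r hr using hφ
  refine ⟨bind₁ r p, fun z => ?_⟩
  change eval z (bind₁ r p) = f (φ z)
  rw [← hp, ← coe_aeval_eq_eval, RingHom.coe_coe, aeval_bind₁,
    show φ z = fun i => eval z (r i) from funext fun i => (hr i z).symm]
  rfl

theorem update (i : Fin n) (hf : IsPolyFun f) (j : Fin n) :
    IsPolyFun fun z => Function.update z i (f z) j := by
  by_cases h : j = i
  · subst h
    simpa using hf
  · simpa [h] using coord j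

/-- The ring of polynomial functions has no zero divisors. -/
theorem eq_zero_of_mul (hf : IsPolyFun f) (hg : IsPolyFun g) (h : ∀ z, f z * g z = 0)
    {z₀ : Fin n → ℂ} (hz₀ : g z₀ ≠ 0) (z : Fin n → ℂ) : f z = 0 := by
  obtain ⟨p, hp⟩ := hf
  obtain ⟨q, hq⟩ := hg
  have hpq : p * q = 0 := MvPolynomial.funext fun z => by simp [hp, hq, h]
  rcases mul_eq_zero.1 hpq with rfl | rfl
  · simp [← hp]
  · simp [← hq] at hz₀

/-- Two nonzero polynomial functions have a common point of nonvanishing. -/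
theorem exists_mul_ne_zero (hf : IsPolyFun f) (hg : IsPolyFun g) (hf₀ : ∃ z, f z ≠ 0)
    (hg₀ : ∃ z, g z ≠ 0) : ∃ z, f z ≠ 0 ∧ g z ≠ 0 := by
  by_contra! h
  obtain ⟨z₁, hz₁⟩ := hf₀
  obtain ⟨z₂, hz₂⟩ := hg₀
  exact hz₁ (hf.eq_zero_of_mul hg (fun z => mul_eq_zero.2 (or_iff_not_imp_left.2 (h z))) hz₂ z₁)

/-- Splitting into even and odd part with respect to one variable. -/
theorem exists_even_odd (i : Fin n) (hf : IsPolyFun f) :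
    ∃ f₀ f₁ : (Fin n → ℂ) → ℂ, IsPolyFun f₀ ∧ IsPolyFun f₁ ∧
      ∀ z, f z = f₀ (Function.update z i (z i ^ 2)) + z i * f₁ (Function.update z i (z i ^ 2)) := by
  obtain ⟨p, hp⟩ := hf
  suffices h : ∃ f₀ f₁ : (Fin n → ℂ) → ℂ, IsPolyFun f₀ ∧ IsPolyFun f₁ ∧ ∀ z, eval z p =
      f₀ (Function.update z i (z i ^ 2)) + z i * f₁ (Function.update z i (z i ^ 2)) by
    simpa only [hp] using h
  clear hp
  induction p using MvPolynomial.induction_on with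
  | C a => exact ⟨_, _, const a, const 0, fun z => by simp⟩
  | add p q hp hq =>
    obtain ⟨a, b, ha, hb, h⟩ := hp
    obtain ⟨c, d, hc, hd, h'⟩ := hq
    exact ⟨_, _, ha.add hc, hb.add hd, fun z => by rw [map_add, h, h']; ring⟩
  | mul_X p j hp =>
    obtain ⟨a, b, ha, hb, h⟩ := hp
    by_cases hj : j = i
    · subst hj
      refine ⟨_, _, (coord j).mul hb, ha, fun z => ?_⟩
      rw [map_mul, h, eval_X, Function.update_self]
      ring
    · refine ⟨_, _, (coord j).mul ha, (coord j).mul hb, fun z => ?_⟩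
      rw [map_mul, h, eval_X, Function.update_of_ne hj]
      ring

end IsPolyFun

/-- Squares the coordinates in `S`. -/
def squareOn {n : ℕ} (S : Finset (Fin n)) (z : Fin n → ℂ) : Fin n → ℂ :=
  fun i => if i ∈ S then z i ^ 2 else z i

/-- Changes the sign of the `i`-th coordinate. -/
def flipSign {n : ℕ} (i : Fin n) (z : Fin n → ℂ) : Fin n → ℂ := Function.update z i (-z i)

section squares

variable {n : ℕ} {f : (Fin n → ℂ) → ℂ}

theorem squareOn_surjective (S : Finset (Fin n)) : Function.Surjective (squareOn S) := by
  intro w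
  choose r hr using fun c : ℂ => IsAlgClosed.exists_pow_nat_eq c (n := 2) two_pos
  refine ⟨fun i => if i ∈ S then r (w i) else w i, funext fun i => ?_⟩
  by_cases h : i ∈ S <;> simp [squareOn, h, hr]

theorem squareOn_empty (z : Fin n → ℂ) : squareOn ∅ z = z :=
  funext fun _ => if_neg (Finset.notMem_empty _)

theorem squareOn_insert {S : Finset (Fin n)} {i : Fin n} (hi : i ∉ S) (z : Fin n → ℂ) :
    squareOn (insert i S) z = Function.update (squareOn S z) i (squareOn S z i ^ 2) := by
  ext j
  by_cases h : j = i
  · subst h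
    simp [squareOn, hi]
  · simp [squareOn, h]

theorem squareOn_flipSign {S : Finset (Fin n)} {i : Fin n} (hi : i ∉ S) (z : Fin n → ℂ) :
    squareOn S (flipSign i z) = flipSign i (squareOn S z) := by
  ext j
  by_cases h : j = i
  · subst h
    simp [squareOn, flipSign, hi]
  · simp [squareOn, flipSign, h]

theorem isPolyFun_squareOn (S : Finset (Fin n)) (i : Fin n) :
    IsPolyFun fun z => squareOn S z i := by
  by_cases h : i ∈ S
  · simpa [squareOn, h] using (IsPolyFun.coord i).pow 2
  · simpa [squareOn, h] using IsPolyFun.coord i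

theorem isPolyFun_flipSign (i j : Fin n) : IsPolyFun fun z => flipSign i z j :=
  (IsPolyFun.coord i).neg.update i j

/-- A polynomial invariant under sign changes is a polynomial in the squares. -/
theorem IsPolyFun.exists_comp_squareOn (hf : IsPolyFun f) (S : Finset (Fin n))
    (h : ∀ i ∈ S, ∀ z, f (flipSign i z) = f z) :
    ∃ g : (Fin n → ℂ) → ℂ, IsPolyFun g ∧ ∀ z, f z = g (squareOn S z) := by
  induction S using Finset.induction_on with
  | empty => exact ⟨f, hf, fun z => by rw [squareOn_empty]⟩
  | insert i S hi ih =>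
    obtain ⟨g, hg, hfg⟩ := ih fun j hj => h j (Finset.mem_insert_of_mem hj)
    have hinv : ∀ w, g (flipSign i w) = g w := fun w => by
      obtain ⟨z, rfl⟩ := squareOn_surjective S w
      rw [← squareOn_flipSign hi, ← hfg, ← hfg, h i (Finset.mem_insert_self i S)]
    obtain ⟨a, b, ha, -, hab⟩ := hg.exists_even_odd i
    refine ⟨a, ha, fun z => ?_⟩
    have h₁ := hab (squareOn S z)
    have h₂ := hab (flipSign i (squareOn S z))
    have h₃ : Function.update (flipSign i (squareOn S z)) i (flipSign i (squareOn S z) i ^ 2) =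
        Function.update (squareOn S z) i (squareOn S z i ^ 2) := by
      simp [flipSign]
    rw [h₃, hinv] at h₂
    simp only [flipSign, Function.update_self] at h₂
    rw [hfg, squareOn_insert hi]
    linear_combination (h₁ + h₂) / 2

/-- A nonzero polynomial divides a nonzero polynomial in the squares. -/
theorem IsPolyFun.exists_mul_eq_comp_squareOn (hf : IsPolyFun f) (hf₀ : ∃ z, f z ≠ 0)
    (S : Finset (Fin n)) :
    ∃ c g : (Fin n → ℂ) → ℂ, IsPolyFun c ∧ IsPolyFun g ∧ (∃ z, g z ≠ 0) ∧
      ∀ z, f z * c z = g (squareOn S z) := by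
  induction S using Finset.induction_on with
  | empty => exact ⟨_, f, IsPolyFun.const 1, hf, hf₀, fun z => by rw [squareOn_empty, mul_one]⟩
  | insert i S hi ih =>
    obtain ⟨c, g, hc, hg, ⟨w, hw⟩, hfg⟩ := ih
    obtain ⟨a, b, ha, hb, hab⟩ := hg.exists_even_odd i
    have hflip : ∀ z, g (flipSign i z) = a (Function.update z i (z i ^ 2)) -
        z i * b (Function.update z i (z i ^ 2)) := fun z => by
      rw [hab]
      simp [flipSign, sub_eq_add_neg]
    have hprod : ∀ z, g z * g (flipSign i z) = a (Function.update z i (z i ^ 2)) ^ 2 -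
        Function.update z i (z i ^ 2) i * b (Function.update z i (z i ^ 2)) ^ 2 := fun z => by
      rw [hflip, hab, Function.update_self]
      ring
    have hg' : IsPolyFun fun z => g (flipSign i z) := hg.comp (isPolyFun_flipSign i)
    refine ⟨fun z => c z * g (flipSign i (squareOn S z)), fun z => a z ^ 2 - z i * b z ^ 2,
      hc.mul (hg'.comp (isPolyFun_squareOn S)), (ha.pow 2).sub ((IsPolyFun.coord i).mul (hb.pow 2)),
      ?_, fun z => ?_⟩
    · obtain ⟨z, hz, hz'⟩ := hg.exists_mul_ne_zero hg' ⟨w, hw⟩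
        ⟨flipSign i w, by simpa [flipSign] using hw⟩
      exact ⟨_, (hprod z).symm.trans_ne (mul_ne_zero hz hz')⟩
    · rw [squareOn_insert hi]
      exact (mul_assoc _ _ _).symm.trans ((congrArg (· * _) (hfg z)).trans (hprod _))

/-- Clearing denominators in a polynomial. -/
theorem IsPolyFun.exists_clear_denominator {m : ℕ} (hf : IsPolyFun f) {e : (Fin m → ℂ) → ℂ}
    (he : IsPolyFun e) {r : (Fin m → ℂ) → Fin n → ℂ}
    (hr : ∀ i, ∃ h, IsPolyFun h ∧ ∀ y, e y ≠ 0 → h y = e y * r y i) :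
    ∃ (P : MvPolynomial (Fin m) ℂ) (k : ℕ), ∀ y, e y ≠ 0 → eval y P = e y ^ k * f (r y) := by
  obtain ⟨p, hp⟩ := hf
  suffices h : ∃ (P : MvPolynomial (Fin m) ℂ) (k : ℕ), ∀ y, e y ≠ 0 →
      eval y P = e y ^ k * eval (r y) p by
    simpa only [hp] using h
  clear hp
  obtain ⟨E, hE⟩ := he
  choose h hh hhr using hr
  choose R hR using hh
  induction p using MvPolynomial.induction_on with
  | C a => exact ⟨C a, 0, fun y _ => by simp⟩
  | add p q hp hq =>
    obtain ⟨P, k, hP⟩ := hp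
    obtain ⟨Q, l, hQ⟩ := hq
    refine ⟨E ^ l * P + E ^ k * Q, k + l, fun y hy => ?_⟩
    simp only [map_add, map_mul, map_pow, hE, hP y hy, hQ y hy]
    ring
  | mul_X p j hp =>
    obtain ⟨P, k, hP⟩ := hp
    refine ⟨P * R j, k + 1, fun y hy => ?_⟩
    simp only [map_mul, eval_X, hP y hy, hR, hhr j y hy]
    ring

end squares

section SO3

variable {g h : Matrix (Fin 3) (Fin 3) ℂ}

theorem SO3.mul (hg : SO3 g) (hh : SO3 h) : SO3 (g * h) := by
  refine ⟨?_, by rw [det_mul, hg.2, hh.2, mul_one]⟩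
  rw [transpose_mul, Matrix.mul_assoc, ← Matrix.mul_assoc gᵀ, hg.1, Matrix.one_mul, hh.1]

theorem SO3.mul_transpose (hg : SO3 g) : g * gᵀ = 1 := mul_eq_one_comm.1 hg.1

theorem SO3.transpose (hg : SO3 g) : SO3 gᵀ :=
  ⟨by rw [transpose_transpose, hg.mul_transpose], by rw [det_transpose, hg.2]⟩

theorem SO3.dotProduct (hg : SO3 g) (u v : Fin 3 → ℂ) : g *ᵥ u ⬝ᵥ g *ᵥ v = u ⬝ᵥ v := by
  rw [dotProduct_mulVec, vecMul_mulVec, hg.1, ← dotProduct_mulVec, one_mulVec]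

theorem cross_mulVec_mulVec (g : Matrix (Fin 3) (Fin 3) ℂ) (u v : Fin 3 → ℂ) :
    (g *ᵥ u) ⨯₃ (g *ᵥ v) = (g.adjugate)ᵀ *ᵥ (u ⨯₃ v) := by
  ext i
  fin_cases i <;>
    simp [cross_apply, adjugate_fin_three, mulVec, dotProduct, Fin.sum_univ_three] <;> ring

theorem SO3.cross (hg : SO3 g) (u v : Fin 3 → ℂ) :
    (g *ᵥ u) ⨯₃ (g *ᵥ v) = g *ᵥ (u ⨯₃ v) := by
  have h : g.adjugate = gᵀ := by
    have := congrArg (gᵀ * ·) g.mul_adjugate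
    simpa [← Matrix.mul_assoc, hg.1, hg.2] using this
  rw [cross_mulVec_mulVec, h, transpose_transpose]

/-- Two vectors spanning a nondegenerate plane can be rotated into standard position. -/
theorem exists_SO3_frame_s15 {a b : Fin 3 → ℂ} (ha : a ⬝ᵥ a ≠ 0)
    (hab : (a ⨯₃ b) ⬝ᵥ (a ⨯₃ b) ≠ 0) :
    ∃ g, SO3 g ∧ ∃ s t : ℂ, s ≠ 0 ∧ t ≠ 0 ∧ g *ᵥ ![s, 0, 0] = a ∧ g *ᵥ ![0, 0, t] = a ⨯₃ b := by
  obtain ⟨s, hs⟩ := IsAlgClosed.exists_pow_nat_eq (a ⬝ᵥ a) two_pos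
  obtain ⟨t, ht⟩ := IsAlgClosed.exists_pow_nat_eq ((a ⨯₃ b) ⬝ᵥ (a ⨯₃ b)) two_pos
  have hs₀ : s ≠ 0 := by rintro rfl; simp [← hs] at ha
  have ht₀ : t ≠ 0 := by rintro rfl; simp [← ht] at hab
  have hort : a ⬝ᵥ (a ⨯₃ b) = 0 := dot_self_cross a b
  generalize a ⨯₃ b = w at *
  simp only [dotProduct, Fin.sum_univ_three] at hs ht hort
  set e := s⁻¹ • a with he
  set f := t⁻¹ • w with hf
  have hee : e 0 * e 0 + e 1 * e 1 + e 2 * e 2 = 1 := by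
    simp only [he, Pi.smul_apply, smul_eq_mul]
    field_simp
    linear_combination -hs
  have hff : f 0 * f 0 + f 1 * f 1 + f 2 * f 2 = 1 := by
    simp only [hf, Pi.smul_apply, smul_eq_mul]
    field_simp
    linear_combination -ht
  have hef : e 0 * f 0 + e 1 * f 1 + e 2 * f 2 = 0 := by
    simp only [he, hf, Pi.smul_apply, smul_eq_mul]
    field_simp
    linear_combination hort
  have hdet : (f ⨯₃ e) ⬝ᵥ (f ⨯₃ e) = 1 := by
    rw [cross_dot_cross]
    simp only [dotProduct, Fin.sum_univ_three]
    linear_combination (f 0 * f 0 + f 1 * f 1 + f 2 * f 2) * hee + hff -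
      (e 0 * f 0 + e 1 * f 1 + e 2 * f 2) * hef
  simp only [cross_apply, dotProduct, Fin.sum_univ_three, cons_val] at hdet
  refine ⟨(of ![e, f ⨯₃ e, f])ᵀ, ⟨?_, ?_⟩, s, t, hs₀, ht₀, ?_, ?_⟩
  · rw [transpose_transpose]
    ext i j
    fin_cases i <;> fin_cases j <;>
      simp [Matrix.mul_apply, Fin.sum_univ_three, cross_apply] <;>
      first
        | linear_combination hee
        | linear_combination hff
        | linear_combination hef
        | linear_combination hdet
        | ring
  · rw [det_transpose, det_fin_three]
    simp [cross_apply]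
    linear_combination hdet
  · ext i
    fin_cases i <;> simp [mulVec, dotProduct, Fin.sum_univ_three, he] <;> field_simp
  · ext i
    fin_cases i <;> simp [mulVec, dotProduct, Fin.sum_univ_three, hf] <;> field_simp

end SO3

section action

variable {R : Type*}

/-- The first vector of a triple. -/
def fstVec (x : Fin 15 → R) : Fin 3 → R := ![x 0, x 1, x 2]

/-- The second vector of a triple. -/
def sndVec (x : Fin 15 → R) : Fin 3 → R := ![x 3, x 4, x 5]

/-- The matrix of a triple. -/
def corrMat (x : Fin 15 → R) : Matrix (Fin 3) (Fin 3) R :=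
  !![x 6, x 7, x 8; x 9, x 10, x 11; x 12, x 13, x 14]

theorem triple_ext {x y : Fin 15 → R} (h₁ : fstVec x = fstVec y) (h₂ : sndVec x = sndVec y)
    (h₃ : corrMat x = corrMat y) : x = y := by
  ext i
  fin_cases i
  exacts [congrFun h₁ 0, congrFun h₁ 1, congrFun h₁ 2, congrFun h₂ 0, congrFun h₂ 1,
    congrFun h₂ 2, congrFun₂ h₃ 0 0, congrFun₂ h₃ 0 1, congrFun₂ h₃ 0 2, congrFun₂ h₃ 1 0,
    congrFun₂ h₃ 1 1, congrFun₂ h₃ 1 2, congrFun₂ h₃ 2 0, congrFun₂ h₃ 2 1, congrFun₂ h₃ 2 2]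

variable (g₁ g₂ h₁ h₂ : Matrix (Fin 3) (Fin 3) ℂ) (x : Fin 15 → ℂ)

theorem fstVec_genAct : fstVec (genAct g₁ g₂ x) = g₁ *ᵥ fstVec x := by
  ext i
  fin_cases i <;> rfl

theorem sndVec_genAct : sndVec (genAct g₁ g₂ x) = g₂ *ᵥ sndVec x := by
  ext i
  fin_cases i <;> rfl

theorem corrMat_genAct : corrMat (genAct g₁ g₂ x) = g₁ * corrMat x * g₂ᵀ := by
  ext i j
  fin_cases i <;> fin_cases j <;> rfl

theorem genAct_genAct : genAct g₁ g₂ (genAct h₁ h₂ x) = genAct (g₁ * h₁) (g₂ * h₂) x := by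
  apply triple_ext <;>
    simp only [fstVec_genAct, sndVec_genAct, corrMat_genAct, mulVec_mulVec, transpose_mul,
      Matrix.mul_assoc]

theorem genAct_one : genAct 1 1 x = x := by
  apply triple_ext <;> simp [fstVec_genAct, sndVec_genAct, corrMat_genAct]

theorem isPolyFun_genAct (i : Fin 15) : IsPolyFun fun x => genAct g₁ g₂ x i := by
  have hC : ∀ j k : Fin 3, IsPolyFun fun x => corrMat x j k := fun j k => by
    fin_cases j <;> fin_cases k <;> exact IsPolyFun.coord _
  have h₁ : ∀ j : Fin 3, IsPolyFun fun x => (g₁ *ᵥ fstVec x) j := fun j => by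
    simp only [mulVec, dotProduct, Fin.sum_univ_three]
    exact (((IsPolyFun.const _).mul (.coord 0)).add ((IsPolyFun.const _).mul (.coord 1))).add
      ((IsPolyFun.const _).mul (.coord 2))
  have h₂ : ∀ j : Fin 3, IsPolyFun fun x => (g₂ *ᵥ sndVec x) j := fun j => by
    simp only [mulVec, dotProduct, Fin.sum_univ_three]
    exact (((IsPolyFun.const _).mul (.coord 3)).add ((IsPolyFun.const _).mul (.coord 4))).add
      ((IsPolyFun.const _).mul (.coord 5))
  have h₃ : ∀ j k : Fin 3, IsPolyFun fun x => (g₁ * corrMat x * g₂ᵀ) j k := fun j k => by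
    simp only [Matrix.mul_apply, Fin.sum_univ_three]
    have h : ∀ l, IsPolyFun fun x => (g₁ j 0 * corrMat x 0 l + g₁ j 1 * corrMat x 1 l +
        g₁ j 2 * corrMat x 2 l) * g₂ᵀ l k := fun l =>
      ((((IsPolyFun.const _).mul (hC 0 l)).add ((IsPolyFun.const _).mul (hC 1 l))).add
        ((IsPolyFun.const _).mul (hC 2 l))).mul (.const _)
    exact ((h 0).add (h 1)).add (h 2)
  fin_cases i
  exacts [h₁ 0, h₁ 1, h₁ 2, h₂ 0, h₂ 1, h₂ 2, h₃ 0 0, h₃ 0 1, h₃ 0 2, h₃ 1 0, h₃ 1 1, h₃ 1 2,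
    h₃ 2 0, h₃ 2 1, h₃ 2 2]

end action

section invariants

variable {R : Type*} [CommRing R]

/-- Nine invariants of two vectors and a matrix. -/
def invariantsOf (a c : Fin 3 → R) (C : Matrix (Fin 3) (Fin 3) R) : Fin 9 → R :=
  let b := C *ᵥ c
  let d := Cᵀ *ᵥ a
  let w := a ⨯₃ b
  let w' := c ⨯₃ d
  let v := a ⨯₃ w
  let v' := c ⨯₃ w'
  ![a ⬝ᵥ a, c ⬝ᵥ c, a ⬝ᵥ b, w ⬝ᵥ w, w' ⬝ᵥ w', v ⬝ᵥ C *ᵥ v', v ⬝ᵥ C *ᵥ w', w ⬝ᵥ C *ᵥ v',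
    w ⬝ᵥ C *ᵥ w']

/-- The nine fundamental invariants of a triple. -/
def tripleInvariants (x : Fin 15 → R) : Fin 9 → R :=
  invariantsOf (fstVec x) (sndVec x) (corrMat x)

theorem tripleInvariants_map {S : Type*} [CommRing S] (φ : R →+* S) (x : Fin 15 → R) (i : Fin 9) :
    φ (tripleInvariants x i) = tripleInvariants (fun j => φ (x j)) i := by
  have hfst : fstVec (fun j => φ (x j)) = φ ∘ fstVec x := by
    ext j
    fin_cases j <;> rfl
  have hsnd : sndVec (fun j => φ (x j)) = φ ∘ sndVec x := by
    ext j
    fin_cases j <;> rfl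
  have hcorr : corrMat (fun j => φ (x j)) = (corrMat x).map φ := by
    ext j k
    fin_cases j <;> fin_cases k <;> rfl
  have htr : ((corrMat x).map φ)ᵀ = (corrMat x)ᵀ.map φ := rfl
  have hmulVec : ∀ (A : Matrix (Fin 3) (Fin 3) R) u, A.map φ *ᵥ (φ ∘ u) = φ ∘ (A *ᵥ u) :=
    fun A u => funext fun j => (φ.map_mulVec A u j).symm
  have hcross : ∀ u v : Fin 3 → R, (φ ∘ u) ⨯₃ (φ ∘ v) = φ ∘ (u ⨯₃ v) := fun u v => by
    ext j
    fin_cases j <;> simp [cross_apply]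
  have hdot : ∀ u v : Fin 3 → R, (φ ∘ u) ⬝ᵥ (φ ∘ v) = φ (u ⬝ᵥ v) :=
    fun u v => (φ.map_dotProduct u v).symm
  simp only [tripleInvariants, invariantsOf, hfst, hsnd, hcorr, htr, hmulVec, hcross,
    hdot]
  fin_cases i <;> rfl

theorem eval_tripleInvariants_X (x : Fin 15 → ℂ) (i : Fin 9) :
    eval x (tripleInvariants (X : Fin 15 → MvPolynomial (Fin 15) ℂ) i) = tripleInvariants x i := by
  simp [tripleInvariants_map]

theorem eval_aeval_tripleInvariants_X (x : Fin 15 → ℂ) (P : MvPolynomial (Fin 9) ℂ) :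
    eval x (aeval (tripleInvariants (X : Fin 15 → MvPolynomial (Fin 15) ℂ)) P) =
      eval (tripleInvariants x) P := by
  rw [← funext (eval_tripleInvariants_X x)]
  induction P using MvPolynomial.induction_on with
  | C a => simp
  | add p q hp hq => simp only [map_add, hp, hq]
  | mul_X p i hp => simp only [map_mul, aeval_X, eval_X, hp]

theorem tripleInvariants_genAct {g₁ g₂ : Matrix (Fin 3) (Fin 3) ℂ} (h₁ : SO3 g₁) (h₂ : SO3 g₂)
    (x : Fin 15 → ℂ) : tripleInvariants (genAct g₁ g₂ x) = tripleInvariants x := by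
  have hC : ∀ v, (g₁ * corrMat x * g₂ᵀ) *ᵥ g₂ *ᵥ v = g₁ *ᵥ corrMat x *ᵥ v := fun v => by
    rw [mulVec_mulVec, mulVec_mulVec, Matrix.mul_assoc, h₂.1, Matrix.mul_one]
  have hCt : ∀ v, (g₁ * corrMat x * g₂ᵀ)ᵀ *ᵥ g₁ *ᵥ v = g₂ *ᵥ (corrMat x)ᵀ *ᵥ v := fun v => by
    rw [mulVec_mulVec, mulVec_mulVec, transpose_mul, transpose_mul, transpose_transpose,
      Matrix.mul_assoc, Matrix.mul_assoc, h₁.1, Matrix.mul_one]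
  simp only [tripleInvariants, invariantsOf, fstVec_genAct, sndVec_genAct, corrMat_genAct, hC, hCt,
    h₁.cross, h₂.cross, h₁.dotProduct, h₂.dotProduct]

/-- A parametrized section of the action. -/
def sectionPoint (z : Fin 9 → ℂ) : Fin 15 → ℂ :=
  ![z 0, 0, 0, z 1, 0, 0, z 0 * z 1 * z 4, z 2, 0,
    z 3, z 0 * z 1 * z 2 * z 3 * z 5, z 0 * z 2 * z 3 * z 6,
    0, z 1 * z 2 * z 3 * z 7, z 2 * z 3 * z 8]

theorem isPolyFun_sectionPoint (i : Fin 15) : IsPolyFun fun z => sectionPoint z i := by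
  have h : ∀ j : Fin 9, IsPolyFun fun z : Fin 9 → ℂ => z j := .coord
  fin_cases i
  exacts [h 0, .const 0, .const 0, h 1, .const 0, .const 0, ((h 0).mul (h 1)).mul (h 4), h 2,
    .const 0, h 3, ((((h 0).mul (h 1)).mul (h 2)).mul (h 3)).mul (h 5),
    (((h 0).mul (h 2)).mul (h 3)).mul (h 6), .const 0, (((h 1).mul (h 2)).mul (h 3)).mul (h 7),
    ((h 2).mul (h 3)).mul (h 8)]

/-- The invariants of a point of the section, in terms of the squares of the first four
parameters. -/
def sectionInvariants (w : Fin 9 → ℂ) : Fin 9 → ℂ :=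
  ![w 0, w 1, w 0 * w 1 * w 4, w 0 * w 1 * w 3, w 0 * w 1 * w 2,
    w 0 ^ 2 * w 1 ^ 2 * w 2 * w 3 * w 5, -(w 0 ^ 2 * w 1 * w 2 * w 3 * w 6),
    -(w 0 * w 1 ^ 2 * w 2 * w 3 * w 7), w 0 * w 1 * w 2 * w 3 * w 8]

theorem tripleInvariants_sectionPoint (z : Fin 9 → ℂ) :
    tripleInvariants (sectionPoint z) = sectionInvariants (squareOn {0, 1, 2, 3} z) := by
  ext i
  fin_cases i <;>
    simp [tripleInvariants, invariantsOf, fstVec, sndVec, corrMat, cross_apply, mulVec,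
      dotProduct, Fin.sum_univ_three, sectionPoint, sectionInvariants, squareOn] <;> ring

/-- The inverse of `sectionInvariants`. -/
noncomputable def sectionParams (y : Fin 9 → ℂ) : Fin 9 → ℂ :=
  ![y 0, y 1, y 4 / (y 0 * y 1), y 3 / (y 0 * y 1), y 2 / (y 0 * y 1), y 5 / (y 3 * y 4),
    -(y 6 * y 1 / (y 3 * y 4)), -(y 7 * y 0 / (y 3 * y 4)), y 8 * y 0 * y 1 / (y 3 * y 4)]

/-- The common denominator of `sectionParams`. -/
def sectionDenom (y : Fin 9 → ℂ) : ℂ := y 0 * y 1 * y 3 * y 4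

theorem isPolyFun_sectionDenom : IsPolyFun sectionDenom :=
  (((IsPolyFun.coord 0).mul (.coord 1)).mul (.coord 3)).mul (.coord 4)

theorem sectionInvariants_sectionParams {y : Fin 9 → ℂ} (hy : sectionDenom y ≠ 0) :
    sectionInvariants (sectionParams y) = y := by
  simp only [sectionDenom, ne_eq, mul_eq_zero, not_or] at hy
  obtain ⟨⟨⟨h₀, h₁⟩, h₃⟩, h₄⟩ := hy
  ext i
  fin_cases i <;> simp [sectionInvariants, sectionParams] <;> field_simp

theorem sectionParams_sectionInvariants {w : Fin 9 → ℂ} (hw : w 0 * w 1 * w 2 * w 3 ≠ 0) :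
    sectionParams (sectionInvariants w) = w := by
  simp only [ne_eq, mul_eq_zero, not_or] at hw
  obtain ⟨⟨⟨h₀, h₁⟩, h₂⟩, h₃⟩ := hw
  ext i
  fin_cases i <;> simp [sectionInvariants, sectionParams] <;> field_simp

theorem sectionDenom_sectionInvariants (w : Fin 9 → ℂ) :
    sectionDenom (sectionInvariants w) = w 0 ^ 3 * w 1 ^ 3 * w 2 * w 3 := by
  simp [sectionDenom, sectionInvariants]
  ring

theorem exists_sectionDenom_mul_sectionParams (i : Fin 9) :
    ∃ h, IsPolyFun h ∧ ∀ y, sectionDenom y ≠ 0 → h y = sectionDenom y * sectionParams y i := by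
  have h : ∀ j : Fin 9, IsPolyFun fun y : Fin 9 → ℂ => y j := .coord
  have key : ∃ r, IsPolyFun r ∧ ∀ y, y 0 ≠ 0 → y 1 ≠ 0 → y 3 ≠ 0 → y 4 ≠ 0 →
      r y = sectionDenom y * sectionParams y i := by
    fin_cases i
    · exact ⟨_, isPolyFun_sectionDenom.mul (h 0), fun y _ _ _ _ => rfl⟩
    · exact ⟨_, isPolyFun_sectionDenom.mul (h 1), fun y _ _ _ _ => rfl⟩
    · refine ⟨_, ((h 3).mul (h 4)).mul (h 4), fun y h₀ h₁ h₃ h₄ => ?_⟩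
      simp [sectionDenom, sectionParams]
      field_simp
    · refine ⟨_, ((h 3).mul (h 4)).mul (h 3), fun y h₀ h₁ h₃ h₄ => ?_⟩
      simp [sectionDenom, sectionParams]
      field_simp
    · refine ⟨_, ((h 3).mul (h 4)).mul (h 2), fun y h₀ h₁ h₃ h₄ => ?_⟩
      simp [sectionDenom, sectionParams]
      field_simp
    · refine ⟨_, ((h 0).mul (h 1)).mul (h 5), fun y h₀ h₁ h₃ h₄ => ?_⟩
      simp [sectionDenom, sectionParams]
      field_simp
    · refine ⟨_, (((h 0).mul (h 1)).mul ((h 6).mul (h 1))).neg, fun y h₀ h₁ h₃ h₄ => ?_⟩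
      simp [sectionDenom, sectionParams]
      field_simp
    · refine ⟨_, (((h 0).mul (h 1)).mul ((h 7).mul (h 0))).neg, fun y h₀ h₁ h₃ h₄ => ?_⟩
      simp [sectionDenom, sectionParams]
      field_simp
    · refine ⟨_, ((h 0).mul (h 1)).mul (((h 8).mul (h 0)).mul (h 1)), fun y h₀ h₁ h₃ h₄ => ?_⟩
      simp [sectionDenom, sectionParams]
      field_simp
  obtain ⟨r, hr, hry⟩ := key
  refine ⟨r, hr, fun y hy => ?_⟩
  simp only [sectionDenom, ne_eq, mul_eq_zero, not_or] at hy
  exact hry y hy.1.1.1 hy.1.1.2 hy.1.2 hy.2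

theorem exists_sectionPoint {y : Fin 9 → ℂ} (hy : sectionDenom y ≠ 0) :
    ∃ z, squareOn {0, 1, 2, 3} z = sectionParams y ∧ tripleInvariants (sectionPoint z) = y := by
  obtain ⟨z, hz⟩ := squareOn_surjective {0, 1, 2, 3} (sectionParams y)
  exact ⟨z, hz, by rw [tripleInvariants_sectionPoint, hz, sectionInvariants_sectionParams hy]⟩

/-- Generic triples are equivalent to points of the section. -/
theorem exists_genAct_sectionPoint {x : Fin 15 → ℂ} (hx : sectionDenom (tripleInvariants x) ≠ 0) :
    ∃ g₁ g₂, SO3 g₁ ∧ SO3 g₂ ∧ ∃ z, x = genAct g₁ g₂ (sectionPoint z) ∧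
      squareOn {0, 1, 2, 3} z = sectionParams (tripleInvariants x) := by
  have hx' := hx
  simp only [sectionDenom, ne_eq, mul_eq_zero, not_or] at hx'
  obtain ⟨⟨⟨h₀, h₁⟩, h₃⟩, h₄⟩ := hx'
  obtain ⟨g₁, hg₁, s₁, t₁, hs₁, ht₁, hgs₁, hgt₁⟩ := exists_SO3_frame_s15 h₀ h₃
  obtain ⟨g₂, hg₂, s₂, t₂, hs₂, ht₂, hgs₂, hgt₂⟩ := exists_SO3_frame_s15 h₁ h₄
  set x' := genAct g₁ᵀ g₂ᵀ x with hx'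
  have hxx' : x = genAct g₁ g₂ x' := by
    rw [hx', genAct_genAct, hg₁.mul_transpose, hg₂.mul_transpose, genAct_one]
  have hinv : tripleInvariants x' = tripleInvariants x :=
    tripleInvariants_genAct hg₁.transpose hg₂.transpose x
  have hfst : fstVec x' = ![s₁, 0, 0] := by
    rw [hx', fstVec_genAct, ← hgs₁, mulVec_mulVec, hg₁.1, one_mulVec]
  have hsnd : sndVec x' = ![s₂, 0, 0] := by
    rw [hx', sndVec_genAct, ← hgs₂, mulVec_mulVec, hg₂.1, one_mulVec]
  have hcorr : corrMat x' = g₁ᵀ * corrMat x * g₂ := by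
    rw [hx', corrMat_genAct, transpose_transpose]
  have hentry : ∀ u v, u ⬝ᵥ corrMat x' *ᵥ v = g₁ *ᵥ u ⬝ᵥ corrMat x *ᵥ g₂ *ᵥ v := fun u v => by
    rw [hcorr, Matrix.mul_assoc, ← mulVec_mulVec, dotProduct_mulVec, vecMul_transpose,
      ← mulVec_mulVec]
  have h₁₃ : corrMat x' 0 2 = 0 := by
    have h := hentry ![s₁, 0, 0] ![0, 0, t₂]
    rw [hgs₁, hgt₂, dotProduct_mulVec (fstVec x), ← mulVec_transpose, dot_cross_self] at h
    simpa [mulVec, dotProduct, Fin.sum_univ_three, hs₁, ht₂] using h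
  have h₃₁ : corrMat x' 2 0 = 0 := by
    have h := hentry ![0, 0, t₁] ![s₂, 0, 0]
    rw [hgs₂, hgt₁, dotProduct_comm (_ ⨯₃ _), dot_cross_self] at h
    simpa [mulVec, dotProduct, Fin.sum_univ_three, hs₂, ht₁] using h
  have h₂₁ : corrMat x' 1 0 ≠ 0 := fun h => h₃ <| by
    rw [← hinv]
    simp [tripleInvariants, invariantsOf, hfst, hsnd, cross_apply, mulVec, dotProduct,
      Fin.sum_univ_three, h, h₃₁]
  have h₁₂ : corrMat x' 0 1 ≠ 0 := fun h => h₄ <| by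
    rw [← hinv]
    simp [tripleInvariants, invariantsOf, hfst, hsnd, cross_apply, mulVec, dotProduct,
      Fin.sum_univ_three, h, h₁₃]
  let l := corrMat x' 0 1
  let m := corrMat x' 1 0
  let z : Fin 9 → ℂ := ![s₁, s₂, l, m, corrMat x' 0 0 / (s₁ * s₂),
    corrMat x' 1 1 / (s₁ * s₂ * l * m), corrMat x' 1 2 / (s₁ * l * m),
    corrMat x' 2 1 / (s₂ * l * m), corrMat x' 2 2 / (l * m)]
  have hl : l ≠ 0 := h₁₂
  have hm : m ≠ 0 := h₂₁
  have hz : x' = sectionPoint z := by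
    apply triple_ext
    · rw [hfst]
      rfl
    · rw [hsnd]
      rfl
    · ext i j
      fin_cases i <;> fin_cases j <;> simp [corrMat, sectionPoint, z]
      · change corrMat x' 0 0 = _
        field_simp
        rfl
      · rfl
      · exact h₁₃
      · rfl
      · change corrMat x' 1 1 = _
        field_simp
        rfl
      · change corrMat x' 1 2 = _
        field_simp
        rfl
      · exact h₃₁
      · change corrMat x' 2 1 = _
        field_simp
        rfl
      · change corrMat x' 2 2 = _
        field_simp
        rfl
  refine ⟨g₁, g₂, hg₁, hg₂, z, hz ▸ hxx', ?_⟩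
  rw [← hinv, hz, tripleInvariants_sectionPoint, sectionParams_sectionInvariants]
  simp [squareOn, z, hs₁, hs₂, hl, hm]

end invariants

section main

variable {p q : MvPolynomial (Fin 15) ℂ}

/-- The rational function `p / q` is invariant under the action. -/
def InvariantRatio (p q : MvPolynomial (Fin 15) ℂ) : Prop :=
  ∀ g₁ g₂ : Matrix (Fin 3) (Fin 3) ℂ, SO3 g₁ → SO3 g₂ → ∀ x : Fin 15 → ℂ,
    eval (genAct g₁ g₂ x) p * eval x q = eval x p * eval (genAct g₁ g₂ x) q

theorem InvariantRatio.eval_mul_eval (h : InvariantRatio p q)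
    {g₁ g₂ h₁ h₂ : Matrix (Fin 3) (Fin 3) ℂ} (hg₁ : SO3 g₁) (hg₂ : SO3 g₂) (hh₁ : SO3 h₁)
    (hh₂ : SO3 h₂) (x : Fin 15 → ℂ) :
    eval (genAct g₁ g₂ x) p * eval (genAct h₁ h₂ x) q =
      eval (genAct h₁ h₂ x) p * eval (genAct g₁ g₂ x) q := by
  have := h _ _ (hg₁.mul hh₁.transpose) (hg₂.mul hh₂.transpose) (genAct h₁ h₂ x)
  rwa [genAct_genAct, Matrix.mul_assoc, Matrix.mul_assoc, hh₁.1, hh₂.1, Matrix.mul_one,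
    Matrix.mul_one] at this

/-- Sign changes of the first four parameters of the section are induced by the action. -/
theorem exists_genAct_sectionPoint_flipSign {i : Fin 9} (hi : i ∈ ({0, 1, 2, 3} : Finset (Fin 9)))
    (z : Fin 9 → ℂ) : ∃ g₁ g₂, SO3 g₁ ∧ SO3 g₂ ∧
      sectionPoint (flipSign i z) = genAct g₁ g₂ (sectionPoint z) := by
  have hdiag : ∀ d : Fin 3 → ℂ, d * d = 1 → d 0 * d 1 * d 2 = 1 → SO3 (diagonal d) :=
    fun d hd hd' => ⟨by
      rw [diagonal_transpose, diagonal_mul_diagonal]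
      exact (congrArg diagonal hd).trans diagonal_one, by simpa [Fin.prod_univ_three] using hd'⟩
  have h₁ : SO3 (diagonal ![1, -1, -1]) := hdiag _ (by ext j; fin_cases j <;> simp) (by simp)
  have h₂ : SO3 (diagonal ![-1, 1, -1]) := hdiag _ (by ext j; fin_cases j <;> simp) (by simp)
  have h₀ : SO3 (diagonal ![1, 1, 1]) := hdiag _ (by ext j; fin_cases j <;> simp) (by simp)
  simp only [Finset.mem_insert, Finset.mem_singleton] at hi
  rcases hi with rfl | rfl | rfl | rfl
  on_goal 1 => refine ⟨_, _, h₂, h₁, triple_ext ?_ ?_ ?_⟩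
  on_goal 4 => refine ⟨_, _, h₁, h₂, triple_ext ?_ ?_ ?_⟩
  on_goal 7 => refine ⟨_, _, h₀, h₁, triple_ext ?_ ?_ ?_⟩
  on_goal 10 => refine ⟨_, _, h₁, h₀, triple_ext ?_ ?_ ?_⟩
  all_goals
    simp only [fstVec_genAct, sndVec_genAct, corrMat_genAct]
    first
      | ext j k
        fin_cases j <;> fin_cases k <;>
          simp [corrMat, sectionPoint, flipSign, mul_diagonal, diagonal_mul]
      | ext j
        fin_cases j <;> simp [fstVec, sndVec, sectionPoint, flipSign, mulVec_diagonal]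

theorem algebraicIndependent_tripleInvariants :
    AlgebraicIndependent ℂ (tripleInvariants (X : Fin 15 → MvPolynomial (Fin 15) ℂ)) := by
  rw [algebraicIndependent_iff]
  intro P hP
  refine MvPolynomial.funext fun y => ?_
  rw [map_zero]
  refine IsPolyFun.eq_zero_of_mul ⟨P, fun _ => rfl⟩ isPolyFun_sectionDenom (fun y => ?_)
    (z₀ := fun _ => 1) (by simp [sectionDenom]) y
  by_cases hy : sectionDenom y = 0
  · rw [hy, mul_zero]
  · obtain ⟨z, -, hz⟩ := exists_sectionPoint hy
    rw [← hz, ← eval_aeval_tripleInvariants_X, hP, map_zero, zero_mul]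

theorem exists_sectionDenom_tripleInvariants_ne_zero :
    ∃ x : Fin 15 → ℂ, sectionDenom (tripleInvariants x) ≠ 0 := by
  obtain ⟨z, -, hz⟩ := exists_sectionPoint (y := fun _ => 1) (by simp [sectionDenom])
  exact ⟨sectionPoint z, by simp [hz, sectionDenom]⟩

theorem isPolyFun_tripleInvariants (i : Fin 9) : IsPolyFun fun x => tripleInvariants x i :=
  ⟨_, fun x => eval_tripleInvariants_X x i⟩

theorem InvariantRatio.exists_eq_aeval_tripleInvariants (h : InvariantRatio p q) (hq : q ≠ 0) :
    ∃ P Q : MvPolynomial (Fin 9) ℂ,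
      aeval (tripleInvariants (X : Fin 15 → MvPolynomial (Fin 15) ℂ)) Q ≠ 0 ∧
      p * aeval (tripleInvariants (X : Fin 15 → MvPolynomial (Fin 15) ℂ)) Q =
        aeval (tripleInvariants (X : Fin 15 → MvPolynomial (Fin 15) ℂ)) P * q := by
  have hdenom : IsPolyFun fun x => sectionDenom (tripleInvariants x) :=
    isPolyFun_sectionDenom.comp isPolyFun_tripleInvariants
  have hq₀ : ∃ x, eval x q ≠ 0 := by
    by_contra! hq'
    exact hq (MvPolynomial.funext fun x => by rw [hq', map_zero])
  obtain ⟨x₀, hqx₀, hx₀⟩ := IsPolyFun.exists_mul_ne_zero ⟨q, fun _ => rfl⟩ hdenom hq₀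
    exists_sectionDenom_tripleInvariants_ne_zero
  obtain ⟨k₁, k₂, hk₁, hk₂, z₀, rfl, -⟩ := exists_genAct_sectionPoint hx₀
  have hsec : ∀ i, IsPolyFun fun z => genAct k₁ k₂ (sectionPoint z) i := fun i =>
    (isPolyFun_genAct k₁ k₂ i).comp isPolyFun_sectionPoint
  have hp' : IsPolyFun fun z => eval (genAct k₁ k₂ (sectionPoint z)) p :=
    IsPolyFun.comp ⟨p, fun _ => rfl⟩ hsec
  have hq' : IsPolyFun fun z => eval (genAct k₁ k₂ (sectionPoint z)) q :=
    IsPolyFun.comp ⟨q, fun _ => rfl⟩ hsec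
  obtain ⟨c, N, hc, hN, ⟨w₀, hw₀⟩, hqc⟩ :=
    hq'.exists_mul_eq_comp_squareOn ⟨z₀, hqx₀⟩ {0, 1, 2, 3}
  have hNsq : IsPolyFun fun z => N (squareOn {0, 1, 2, 3} z) := hN.comp (isPolyFun_squareOn _)
  obtain ⟨z₁, rfl⟩ := squareOn_surjective {0, 1, 2, 3} w₀
  have hflip : ∀ i ∈ ({0, 1, 2, 3} : Finset (Fin 9)), ∀ z,
      eval (genAct k₁ k₂ (sectionPoint (flipSign i z))) p * c (flipSign i z) =
        eval (genAct k₁ k₂ (sectionPoint z)) p * c z := fun i hi z => by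
    have hpc := hp'.mul hc
    refine sub_eq_zero.1 (((hpc.comp (isPolyFun_flipSign i)).sub hpc).eq_zero_of_mul hNsq
      (fun z => ?_) hw₀ z)
    obtain ⟨g₁, g₂, hg₁, hg₂, hz⟩ := exists_genAct_sectionPoint_flipSign hi z
    have hinv := h.eval_mul_eval (hk₁.mul hg₁) (hk₂.mul hg₂) hk₁ hk₂ (sectionPoint z)
    rw [← genAct_genAct, ← hz] at hinv
    have hsq : squareOn {0, 1, 2, 3} (flipSign i z) = squareOn {0, 1, 2, 3} z := by
      ext j
      by_cases hj : j = i
      · subst hj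
        simp [squareOn, flipSign, hi]
      · simp [squareOn, flipSign, hj]
    have h₁ := hqc z
    have h₂ := hqc (flipSign i z)
    rw [hsq] at h₂
    linear_combination c (flipSign i z) * c z * hinv -
      eval (genAct k₁ k₂ (sectionPoint (flipSign i z))) p * c (flipSign i z) * h₁ +
      eval (genAct k₁ k₂ (sectionPoint z)) p * c z * h₂
  obtain ⟨M, hM, hpc⟩ := (hp'.mul hc).exists_comp_squareOn {0, 1, 2, 3} hflip
  obtain ⟨P, k, hP⟩ := hM.exists_clear_denominator isPolyFun_sectionDenom
    exists_sectionDenom_mul_sectionParams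
  obtain ⟨Q, l, hQ⟩ := hN.exists_clear_denominator isPolyFun_sectionDenom
    exists_sectionDenom_mul_sectionParams
  obtain ⟨E, hE⟩ := isPolyFun_sectionDenom
  have hQ₀ : aeval (tripleInvariants (X : Fin 15 → MvPolynomial (Fin 15) ℂ)) (Q * E ^ k) ≠ 0 := by
    obtain ⟨w, hw, hw'⟩ := hN.exists_mul_ne_zero
      (g := fun w => w 0 * w 1 * w 2 * w 3)
      ((((IsPolyFun.coord 0).mul (.coord 1)).mul (.coord 2)).mul (.coord 3)) ⟨_, hw₀⟩
      ⟨fun _ => 1, by simp⟩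
    obtain ⟨z, rfl⟩ := squareOn_surjective {0, 1, 2, 3} w
    intro h₀
    have h₁ := eval_aeval_tripleInvariants_X (sectionPoint z) (Q * E ^ k)
    have h₂ : sectionDenom (sectionInvariants (squareOn {0, 1, 2, 3} z)) ≠ 0 := by
      rw [sectionDenom_sectionInvariants]
      simpa [and_assoc] using hw'
    rw [h₀, map_zero, tripleInvariants_sectionPoint, map_mul, map_pow, hE, hQ _ h₂,
      sectionParams_sectionInvariants hw'] at h₁
    exact mul_ne_zero (mul_ne_zero (pow_ne_zero _ h₂) hw) (pow_ne_zero _ h₂) h₁.symm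
  refine ⟨P * E ^ l, Q * E ^ k, hQ₀, MvPolynomial.funext fun x => sub_eq_zero.1 ?_⟩
  have hQx : ∃ x, eval x (aeval (tripleInvariants (X : Fin 15 → MvPolynomial (Fin 15) ℂ))
      (Q * E ^ k)) ≠ 0 := by
    by_contra! hQ'
    exact hQ₀ (MvPolynomial.funext fun x => by rw [hQ', map_zero])
  obtain ⟨x₁, hx₁, hx₁'⟩ := IsPolyFun.exists_mul_ne_zero ⟨_, fun _ => rfl⟩ hdenom hQx
    exists_sectionDenom_tripleInvariants_ne_zero
  refine IsPolyFun.eq_zero_of_mul (z₀ := x₁)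
    (IsPolyFun.sub ⟨_, fun _ => rfl⟩ ⟨_, fun _ => rfl⟩)
    (IsPolyFun.mul ⟨aeval (tripleInvariants (X : Fin 15 → MvPolynomial (Fin 15) ℂ))
      (Q * E ^ k), fun _ => rfl⟩ hdenom) (fun x => ?_) (mul_ne_zero hx₁ hx₁') x
  by_cases hx : sectionDenom (tripleInvariants x) = 0
  · simp [hx]
  obtain ⟨g₁, g₂, hg₁, hg₂, z, hxz, hz⟩ := exists_genAct_sectionPoint hx
  simp only [map_mul, map_pow, eval_aeval_tripleInvariants_X, hE, hP _ hx, hQ _ hx]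
  have hinv := h.eval_mul_eval hg₁ hg₂ hk₁ hk₂ (sectionPoint z)
  rw [← hxz] at hinv
  have h₁ := hqc z
  have h₂ := hpc z
  rw [hz] at h₁ h₂
  rw [← h₁, ← h₂]
  linear_combination sectionDenom (tripleInvariants x) ^ (k + k + l + l + 1) * c z * c z *
    eval (genAct k₁ k₂ (sectionPoint z)) q * hinv

end main

/-- The field of rational local unitary invariants of mixed states of two qubits is
purely transcendental of transcendence degree 9 over ℂ: there exist nine algebraically
independent invariants `F₁, …, F₉` such that every invariant rational function `p/q`
is a rational function of `F₁, …, F₉`. -/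
theorem invariant_field_rational_degree_nine :
    ∃ F : Fin 9 → MvPolynomial (Fin 15) ℂ,
      (∀ (i : Fin 9) (g₁ g₂ : Matrix (Fin 3) (Fin 3) ℂ), SO3 g₁ → SO3 g₂ →
        ∀ x : Fin 15 → ℂ, eval (genAct g₁ g₂ x) (F i) = eval x (F i)) ∧
      AlgebraicIndependent ℂ F ∧
      ∀ p q : MvPolynomial (Fin 15) ℂ, q ≠ 0 →
        (∀ g₁ g₂ : Matrix (Fin 3) (Fin 3) ℂ, SO3 g₁ → SO3 g₂ → ∀ x : Fin 15 → ℂ,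
          eval (genAct g₁ g₂ x) p * eval x q = eval x p * eval (genAct g₁ g₂ x) q) →
        ∃ P Q : MvPolynomial (Fin 9) ℂ, aeval F Q ≠ 0 ∧
          p * aeval F Q = aeval F P * q := by
  refine ⟨tripleInvariants X, fun i g₁ g₂ h₁ h₂ x => ?_, algebraicIndependent_tripleInvariants,
    fun p q hq h => InvariantRatio.exists_eq_aeval_tripleInvariants h hq⟩
  rw [eval_tripleInvariants_X, eval_tripleInvariants_X, tripleInvariants_genAct h₁ h₂]
end
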